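/- arXiv:1906.11808 — 3 statements merged into one kernel-verified Lean document; each statement's English description precedes it below -/
import Mathlib

section
/- Let (λ_n)_n be a sequence of positive reals with λ_n → ∞, and suppose (B_n)_n is a sequence of sets of integers such that Poi_{λ_n}(B_n) → 0 as n → ∞. Then also Poi_{λ_n}(B_n − ⌊√λ_n⌋) → 0 as n → ∞, where for a set of integers B and an integer k, B − k = { b − k : b ∈ B }. -/
open Filter
open scoped Classical

/-- The mass that the Poisson distribution with mean `lam` (supported on the
nonnegative integers) assigns to a set `B` of integers. -/
noncomputable def poiMass (lam : ℝ) (B : Set ℤ) : ℝ :=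
  ∑' k : ℕ, if (k : ℤ) ∈ B then Real.exp (-lam) * lam ^ k / (Nat.factorial k) else 0

lemma aux_ratio (l : ℝ) (hl : 0 < l) (s k : ℕ) :
    Real.exp (-l) * l ^ k / (Nat.factorial k) ≤
      Real.exp (s * ((k + s) / l - 1)) *
        (Real.exp (-l) * l ^ (k + s) / (Nat.factorial (k + s))) := by
  have h1 : ((k + s).factorial : ℝ) ≤ k.factorial * ((k : ℝ) + s) ^ s := by
    have h := Nat.ascFactorial_le_pow_add k s
    have h2 := Nat.factorial_mul_ascFactorial k s
    have : (k + s).factorial ≤ k.factorial * (k + s) ^ s := by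
      rw [← h2]; exact Nat.mul_le_mul_left _ h
    exact_mod_cast this
  have h2 : (((k : ℝ) + s) / l) ^ s ≤ Real.exp (s * ((k + s) / l - 1)) := by
    rw [Real.exp_nat_mul]
    apply pow_le_pow_left₀ (by positivity)
    have := Real.add_one_le_exp (((k : ℝ) + s) / l - 1)
    linarith
  refine le_trans ?_ (mul_le_mul_of_nonneg_right h2 (by positivity))
  have hk : (0 : ℝ) < k.factorial := by positivity
  have hks : (0 : ℝ) < (k + s).factorial := by positivity
  have e : (((k : ℝ) + s) / l) ^ s * (Real.exp (-l) * l ^ (k + s) / ((k + s).factorial))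
      = Real.exp (-l) * l ^ k * ((k : ℝ) + s) ^ s / (k + s).factorial := by
    rw [div_pow, pow_add]; field_simp
  rw [e, div_le_div_iff₀ hk hks]
  have : 0 ≤ Real.exp (-l) * l ^ k := by positivity
  nlinarith [mul_le_mul_of_nonneg_left h1 this]

lemma aux_hasSum (x : ℝ) : HasSum (fun k : ℕ => x ^ k / (k.factorial : ℝ)) (Real.exp x) := by
  rw [Real.exp_eq_exp_ℝ]
  exact NormedSpace.expSeries_div_hasSum_exp x

lemma aux_q (l : ℝ) (hl : 1 ≤ l) (s : ℕ) (hs : (s : ℝ) ≤ Real.sqrt l) :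
    ∃ S ≤ Real.exp 2, HasSum (fun k : ℕ => Real.exp (s * ((k + s) / l - 1)) *
        (Real.exp (-l) * l ^ k / (Nat.factorial k))) S := by
  have hl0 : 0 < l := by linarith
  have hs2 : (s : ℝ) ^ 2 ≤ l := by
    have := pow_le_pow_left₀ (by positivity) hs 2
    rwa [Real.sq_sqrt hl0.le] at this
  obtain ⟨t, ht⟩ : ∃ t : ℝ, t = s / l := ⟨_, rfl⟩
  have hst : (s : ℝ) = l * t := by rw [ht]; field_simp
  have ht0 : 0 ≤ t := by rw [ht]; positivity
  have hlt : l * t ^ 2 ≤ 1 := by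
    rw [hst] at hs2
    by_contra hc
    push Not at hc
    nlinarith
  have ht1 : t ≤ 1 := by nlinarith
  have hb := (abs_le.1 (Real.abs_exp_sub_one_sub_id_le (x := t) (by rw [abs_of_nonneg ht0]; exact ht1))).2
  have H := (aux_hasSum (l * Real.exp t)).mul_left (Real.exp (-l + s * t - s))
  refine ⟨_, ?_, H.congr_fun ?_⟩
  · rw [← Real.exp_add]
    apply Real.exp_le_exp.2
    rw [hst]
    nlinarith
  · intro k
    have : Real.exp (s * ((k + s) / l - 1)) = Real.exp (s * t - s) * Real.exp t ^ k := by
      rw [← Real.exp_nat_mul, ← Real.exp_add, ht]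
      congr 1
      field_simp
      ring
    rw [this, show -l + s * t - s = -l + (s * t - s) by ring, Real.exp_add, mul_pow]
    ring

lemma aux_nonneg (l : ℝ) (hl : 0 < l) (B : Set ℤ) : 0 ≤ poiMass l B := by
  unfold poiMass
  apply tsum_nonneg
  intro k
  split_ifs
  · positivity
  · exact le_rfl

lemma aux_summable (l : ℝ) (hl : 0 < l) (B : Set ℤ) :
    Summable (fun k : ℕ => if (k : ℤ) ∈ B then Real.exp (-l) * l ^ k / (Nat.factorial k) else 0) := by
  refine Summable.of_nonneg_of_le (f := fun k : ℕ => Real.exp (-l) * (l ^ k / (Nat.factorial k)))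
    ?_ ?_ ((aux_hasSum l).mul_left _).summable
  · intro k
    split_ifs
    · positivity
    · exact le_rfl
  · intro k
    split_ifs
    · rw [mul_div_assoc]
    · positivity

lemma aux_main (l : ℝ) (hl : 1 ≤ l) (s : ℕ) (hs : (s : ℝ) ≤ Real.sqrt l) (B : Set ℤ)
    (M : ℝ) (hM : 0 < M) :
    poiMass l ((fun b : ℤ => b - (s : ℤ)) '' B) ≤ M * poiMass l B + Real.exp 2 / M := by
  have hl0 : 0 < l := by linarith
  obtain ⟨S, hS, hq⟩ := aux_q l hl s hs
  have hB := aux_summable l hl0 B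
  have hB' := hB.comp_injective (add_left_injective s)
  have h1 : ∑' k : ℕ, (if ((k + s : ℕ) : ℤ) ∈ B then
      Real.exp (-l) * l ^ (k + s) / (Nat.factorial (k + s)) else 0) ≤ poiMass l B := by
    have := hB.sum_add_tsum_nat_add s
    unfold poiMass
    rw [← this]
    have : 0 ≤ ∑ k ∈ Finset.range s, (if (k : ℤ) ∈ B then
        Real.exp (-l) * l ^ k / (Nat.factorial k) else 0) := by
      apply Finset.sum_nonneg
      intro k _
      split_ifs
      · positivity
      · exact le_rfl
    linarith
  have hR := (hB'.hasSum.mul_left M).add (hq.mul_left M⁻¹)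
  have hle := (aux_summable l hl0 ((fun b : ℤ => b - (s : ℤ)) '' B)).hasSum
  have key := hasSum_le ?_ hle hR
  · change poiMass l _ ≤ _ at key
    refine key.trans ?_
    have h2 : M⁻¹ * S ≤ Real.exp 2 / M := by
      rw [div_eq_inv_mul]; gcongr
    have h3 := mul_le_mul_of_nonneg_left h1 hM.le
    exact add_le_add h3 h2
  · intro k
    have hmem : ((k : ℤ) ∈ (fun b : ℤ => b - (s : ℤ)) '' B) ↔ ((k + s : ℕ) : ℤ) ∈ B := by
      constructor
      · rintro ⟨b, hb, hbk⟩
        have : ((k + s : ℕ) : ℤ) = b := by push_cast; simp only at hbk; omega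
        rwa [this]
      · intro hb
        exact ⟨_, hb, by push_cast; ring⟩
    simp only [Function.comp, hmem]
    split_ifs with hk
    · have hr := aux_ratio l hl0 s k
      set r := Real.exp (s * ((k + s) / l - 1))
      have hp : 0 ≤ Real.exp (-l) * l ^ k / (Nat.factorial k) := by positivity
      have hp' : 0 ≤ Real.exp (-l) * l ^ (k + s) / (Nat.factorial (k + s)) := by positivity
      have hr0 : 0 < r := Real.exp_pos _
      rcases le_total r M with h | h
      · have : 0 ≤ M⁻¹ * (r * (Real.exp (-l) * l ^ k / (Nat.factorial k))) := by positivity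
        have := mul_le_mul_of_nonneg_right h hp'
        linarith
      · have h4 : 0 ≤ M * (Real.exp (-l) * l ^ (k + s) / (Nat.factorial (k + s))) := by positivity
        have h5 : 1 ≤ M⁻¹ * r := by rw [← div_eq_inv_mul, le_div_iff₀ hM]; linarith
        have := mul_le_mul_of_nonneg_right h5 hp
        linarith
    · positivity

/-- If `λ_n → ∞` and `Poi_{λ_n}(B_n) → 0`, then also
`Poi_{λ_n}(B_n − ⌊√λ_n⌋) → 0`, where `B − k = {b − k : b ∈ B}`. -/
theorem stmt7 (lam : ℕ → ℝ) (hpos : ∀ n, 0 < lam n)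
    (hinf : Tendsto lam atTop atTop)
    (B : ℕ → Set ℤ)
    (h : Tendsto (fun n => poiMass (lam n) (B n)) atTop (nhds 0)) :
    Tendsto (fun n => poiMass (lam n)
        ((fun b : ℤ => b - ⌊Real.sqrt (lam n)⌋) '' B n)) atTop (nhds 0) := by
  rw [Metric.tendsto_nhds]
  intro ε hε
  obtain ⟨M, hMdef⟩ : ∃ M : ℝ, M = 2 * Real.exp 2 / ε := ⟨_, rfl⟩
  have hM : 0 < M := by rw [hMdef]; positivity
  have hM2 : Real.exp 2 / M = ε / 2 := by rw [hMdef]; field_simp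
  have hev : ∀ᶠ n in atTop, poiMass (lam n) (B n) < ε / 2 / M :=
    h.eventually_lt_const (by positivity)
  filter_upwards [hev, hinf.eventually_ge_atTop 1] with n hn hl
  have hfl : ((⌊Real.sqrt (lam n)⌋₊ : ℕ) : ℤ) = ⌊Real.sqrt (lam n)⌋ :=
    Int.natCast_floor_eq_floor (Real.sqrt_nonneg _)
  rw [← hfl]
  have hm := aux_main (lam n) hl ⌊Real.sqrt (lam n)⌋₊ (Nat.floor_le (Real.sqrt_nonneg _)) (B n) M hM
  rw [Real.dist_eq, sub_zero, abs_of_nonneg (aux_nonneg _ (hpos n) _)]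
  rw [lt_div_iff₀ hM] at hn
  rw [hM2] at hm
  linarith
end

section
/- Fix ε ∈ (0, 1/4). For n with ε < x(n) < 1/2 − ε, set r = ⌊n^{x(n)/2}⌋ and n′ = n + r·a(n), and let X_a be the number of independent a(n)-sets in G(n,1/2) and X′_a the number of independent a(n)-sets in G(n′,1/2). Then d_TV(X_a, Poi_{μ(n)}) = o(1) and d_TV(X′_a, Poi_{μ(n)}) = o(1); precisely, for every δ > 0 there is N such that for all n ≥ N with ε < x(n) < 1/2 − ε, both total variation distances are at most δ. -/
open Filter

/-- Probability of an event under `G(n,1/2)`, i.e. the uniform measure on all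
simple graphs on `{1,…,n}` (each edge present independently with probability 1/2). -/
noncomputable def Pr (n : ℕ) (B : SimpleGraph (Fin n) → Prop) : ℝ :=
  (Nat.card {G : SimpleGraph (Fin n) // B G} : ℝ) / (Nat.card (SimpleGraph (Fin n)) : ℝ)

/-- A vertex set is independent if it spans no edges of the graph. -/
def IndepSet {n : ℕ} (G : SimpleGraph (Fin n)) (T : Finset (Fin n)) : Prop :=
  ∀ u ∈ T, ∀ v ∈ T, ¬ G.Adj u v

/-- The number of independent `k`-sets of a graph. -/
noncomputable def numIndep (n k : ℕ) (G : SimpleGraph (Fin n)) : ℕ :=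
  Nat.card {T : Finset (Fin n) // T.card = k ∧ IndepSet G T}

/-- `α₀(n) = 2 log₂ n − 2 log₂ log₂ n + 2 log₂ (e/2) + 1`. -/
noncomputable def alpha0 (n : ℕ) : ℝ :=
  2 * Real.logb 2 n - 2 * Real.logb 2 (Real.logb 2 n)
    + 2 * Real.logb 2 (Real.exp 1 / 2) + 1

/-- `a(n) = ⌊α₀(n)⌋`. -/
noncomputable def aa (n : ℕ) : ℕ := ⌊alpha0 n⌋₊

/-- `μ(n) = C(n, a(n)) · 2^{−a(n)(a(n)−1)/2}`. -/
noncomputable def mu (n : ℕ) : ℝ :=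
  (n.choose (aa n) : ℝ) * (2 : ℝ)⁻¹ ^ ((aa n).choose 2)

/-- `x(n) = log μ(n) / log n`, so that `μ(n) = n^{x(n)}`. -/
noncomputable def xx (n : ℕ) : ℝ := Real.log (mu n) / Real.log n

/-- The probability mass function of the Poisson distribution with mean `lam` at `k`. -/
noncomputable def poiPMF (lam : ℝ) (k : ℕ) : ℝ :=
  Real.exp (-lam) * lam ^ k / (Nat.factorial k)

/-- Total variation distance between the distribution (under `G(n,1/2)`) of an
`ℕ`-valued graph functional `X` and the Poisson distribution with mean `lam`. -/
noncomputable def dTVPoi (n : ℕ) (X : SimpleGraph (Fin n) → ℕ) (lam : ℝ) : ℝ :=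
  ⨆ A : Set ℕ, |Pr n (fun G => X G ∈ A) - ∑' k : A, poiPMF lam k|

lemma poi_summable (lam : ℝ) : Summable (fun k => poiPMF lam k) := by
  unfold poiPMF
  simp_rw [mul_div_assoc]
  exact (Real.summable_pow_div_factorial lam).mul_left _

lemma poi_tsum (lam : ℝ) : ∑' k, poiPMF lam k = 1 := by
  unfold poiPMF
  simp_rw [mul_div_assoc]
  rw [tsum_mul_left]
  have : Real.exp lam = ∑' n : ℕ, lam ^ n / (n.factorial : ℝ) := by
    rw [Real.exp_eq_exp_ℝ, NormedSpace.exp_eq_tsum_div]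
  rw [← this, ← Real.exp_add]; simp

lemma poi_nonneg (lam : ℝ) (h : 0 ≤ lam) (k : ℕ) : 0 ≤ poiPMF lam k := by
  unfold poiPMF; positivity

lemma stein_fun (lam : ℝ) (hl : 1 ≤ lam) (A : Set ℕ) :
    ∃ f : ℕ → ℝ, (∀ k, |f k| ≤ 2) ∧ ∀ k : ℕ, lam * f (k+1) - k * f k =
      A.indicator 1 k - ∑' k : A, poiPMF lam k := by
  classical
  have hl0 : 0 < lam := by linarith
  set P : ℝ := ∑' k : A, poiPMF lam k with hP
  have hP' : P = ∑' k, A.indicator (fun k => poiPMF lam k) k := by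
    rw [hP]; exact tsum_subtype A (fun k => poiPMF lam k)
  have hsA : Summable (A.indicator (fun k => poiPMF lam k)) := (poi_summable lam).indicator A
  have hP0 : 0 ≤ P := tsum_nonneg (fun k => poi_nonneg lam hl0.le k)
  have hP1 : P ≤ 1 := by
    rw [hP', ← poi_tsum lam]
    refine Summable.tsum_le_tsum (fun k => ?_) hsA (poi_summable lam)
    exact Set.indicator_le_self' (fun k _ => poi_nonneg lam hl0.le k) k
  set h : ℕ → ℝ := fun k => A.indicator 1 k - P with hh
  have hh1 : ∀ k, |h k| ≤ 1 := by
    intro k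
    simp only [hh, Set.indicator]
    split_ifs <;> rw [abs_le] <;> constructor <;> simp <;> linarith
  set w : ℕ → ℝ := fun j => lam ^ j / (j.factorial : ℝ) with hw
  have hw0 : ∀ j, 0 ≤ w j := fun j => by simp only [hw]; positivity
  have hws : Summable w := Real.summable_pow_div_factorial lam
  have hhw : Summable (fun j => h j * w j) := by
    refine Summable.of_norm_bounded hws (fun j => ?_)
    rw [norm_mul, Real.norm_eq_abs, Real.norm_eq_abs, abs_of_nonneg (hw0 j)]
    exact mul_le_of_le_one_left (hw0 j) (hh1 j)
  have hz : ∑' j, h j * w j = 0 := by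
    have e : ∀ j, h j * w j = Real.exp lam * (A.indicator (fun k => poiPMF lam k) j - P * poiPMF lam j) := by
      intro j
      simp only [hh, hw, Set.indicator, poiPMF]
      have : Real.exp lam * Real.exp (-lam) = 1 := by rw [← Real.exp_add]; simp
      split_ifs
      · simp only [Pi.one_apply]; linear_combination (-(1 - P) * (lam ^ j / (j.factorial : ℝ))) * this
      · linear_combination (P * (lam ^ j / (j.factorial : ℝ))) * this
    simp_rw [e]
    rw [tsum_mul_left, Summable.tsum_sub hsA ((poi_summable lam).mul_left P), tsum_mul_left, poi_tsum, ← hP']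
    simp
  set f : ℕ → ℝ := fun k => match k with
    | 0 => 0
    | k+1 => (k.factorial : ℝ) / lam ^ (k+1) * ∑ j ∈ Finset.range (k+1), h j * w j with hf
  refine ⟨f, ?_, ?_⟩
  · intro k
    rcases k with _ | k
    · simp [hf]
    · simp only [hf]
      rw [abs_mul, abs_of_nonneg (by positivity)]
      by_cases hk : (k:ℝ) ≤ lam
      · have h1 : |∑ j ∈ Finset.range (k+1), h j * w j| ≤ ∑ j ∈ Finset.range (k+1), lam ^ k / (k.factorial : ℝ) := by
          refine (Finset.abs_sum_le_sum_abs _ _).trans (Finset.sum_le_sum fun j hj => ?_)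
          have hjk : j ≤ k := by simpa [Nat.lt_succ_iff] using hj
          rw [abs_mul, abs_of_nonneg (hw0 j)]
          refine (mul_le_of_le_one_left (hw0 j) (hh1 j)).trans ?_
          simp only [hw]
          rw [div_le_div_iff₀ (by positivity) (by positivity)]
          have h2 : (k.factorial : ℝ) ≤ j.factorial * (k:ℝ) ^ (k - j) := by
            have h4 := Nat.factorial_mul_descFactorial (Nat.sub_le k j)
            rw [Nat.sub_sub_self hjk] at h4
            rw [← h4]; push_cast
            gcongr
            exact_mod_cast Nat.descFactorial_le_pow k (k - j)
          have h3 : (k:ℝ) ^ (k-j) ≤ lam ^ (k-j) := by gcongr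
          calc lam ^ j * (k.factorial : ℝ) ≤ lam ^ j * (j.factorial * lam ^ (k - j)) := by
                gcongr; exact h2.trans (by gcongr)
            _ = lam ^ (j + (k-j)) * j.factorial := by rw [pow_add]; ring
            _ = _ := by rw [Nat.add_sub_cancel' hjk]
        rw [Finset.sum_const, Finset.card_range, nsmul_eq_mul] at h1
        calc _ ≤ (k.factorial : ℝ) / lam ^ (k+1) * (((k+1 : ℕ):ℝ) * (lam ^ k / (k.factorial : ℝ))) := by gcongr
          _ = (k+1) / lam := by push_cast; field_simp; ring
          _ ≤ 2 := by rw [div_le_iff₀ hl0]; linarith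
      · push Not at hk
        have h0 := hhw.sum_add_tsum_nat_add (k+1)
        rw [hz] at h0
        have h1 : ∑ j ∈ Finset.range (k+1), h j * w j = - ∑' i, h (i + (k+1)) * w (i + (k+1)) := by linarith
        rw [h1, abs_neg]
        set q : ℝ := lam / (k+2) with hq
        have hk0 : (0:ℝ) < k + 2 := by positivity
        have hq1 : q < 1 := by rw [hq, div_lt_one hk0]; linarith
        have hq0 : 0 ≤ q := by positivity
        have hg := (hasSum_geometric_of_lt_one hq0 hq1).mul_left (lam ^ (k+1) / ((k+1).factorial : ℝ))
        have h2 : ‖∑' i, h (i + (k+1)) * w (i + (k+1))‖ ≤ lam ^ (k+1) / ((k+1).factorial : ℝ) * (1 - q)⁻¹ := by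
          refine tsum_of_norm_bounded hg (fun i => ?_)
          rw [norm_mul, Real.norm_eq_abs, Real.norm_eq_abs, abs_of_nonneg (hw0 _)]
          refine (mul_le_of_le_one_left (hw0 _) (hh1 _)).trans ?_
          simp only [hw, hq]
          have h3 : ((k+1).factorial : ℝ) * ((k:ℝ)+2) ^ i ≤ (i + (k+1)).factorial := by
            have := @Nat.factorial_mul_pow_le_factorial (k+1) i
            rw [add_comm i]
            have h4 : (((k+1).factorial * (k+1+1)^i : ℕ):ℝ) ≤ ((k+1+i).factorial : ℕ) := by exact_mod_cast this
            push_cast at h4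
            convert h4 using 3; ring
          rw [div_pow, div_mul_div_comm, ← pow_add, add_comm (k+1) i]
          gcongr
        rw [Real.norm_eq_abs] at h2
        have h5 : (1 - q)⁻¹ ≤ k + 1 := by
          have : 1 - q = (k + 2 - lam) / (k+2) := by rw [hq]; field_simp
          rw [this, inv_div, div_le_iff₀ (by linarith)]
          nlinarith
        calc _ ≤ (k.factorial : ℝ) / lam ^ (k+1) * (lam ^ (k+1) / ((k+1).factorial : ℝ) * (k+1)) := by
              gcongr; exact h2.trans (by gcongr)
          _ = 1 := by rw [Nat.factorial_succ]; push_cast; field_simp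
          _ ≤ 2 := by norm_num
  · intro k
    rcases k with _ | k
    · simp [hf, hw, hh]; field_simp
    · simp only [hf]
      rw [Finset.sum_range_succ _ (k+1)]
      have : (A.indicator 1 (k+1) - P : ℝ) = h (k+1) := rfl
      rw [this]
      simp only [hw]
      rw [Nat.factorial_succ]; push_cast
      field_simp
      ring
/-- Complete graph on `T`. -/
def KT {m : ℕ} (T : Finset (Fin m)) : SimpleGraph (Fin m) where
  Adj u v := u ≠ v ∧ u ∈ T ∧ v ∈ T
  symm := ⟨fun _ _ h => ⟨h.1.symm, h.2.2, h.2.1⟩⟩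
  loopless := ⟨fun _ h => h.1 rfl⟩

lemma indep_iff {m : ℕ} (G : SimpleGraph (Fin m)) (T : Finset (Fin m)) :
    IndepSet G T ↔ Disjoint G (KT T) := by
  rw [disjoint_iff_inf_le]
  constructor
  · intro h u v huv
    have h1 : G.Adj u v ∧ (KT T).Adj u v := huv
    exact (h u h1.2.2.1 v h1.2.2.2 h1.1).elim
  · intro h u hu v hv huv
    have : (G ⊓ KT T).Adj u v := ⟨huv, huv.ne, hu, hv⟩
    exact h this

lemma KT_inf {m : ℕ} (S T : Finset (Fin m)) : KT S ⊓ KT T = KT (S ∩ T) := by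
  ext u v
  simp only [SimpleGraph.inf_adj, KT, Finset.mem_inter]
  tauto

lemma KT_card {m : ℕ} (T : Finset (Fin m)) : (KT T).edgeSet.ncard = T.card.choose 2 := by
  classical
  rw [← Sym2.card_image_offDiag, ← Set.ncard_coe_finset]
  congr 1
  ext e
  induction e using Sym2.ind with
  | _ u v =>
    simp only [SimpleGraph.mem_edgeSet, KT, Finset.coe_image, Set.mem_image, Finset.mem_coe,
      Finset.mem_offDiag, Prod.exists]
    constructor
    · rintro ⟨h1, h2, h3⟩
      exact ⟨u, v, ⟨h2, h3, h1⟩, rfl⟩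
    · rintro ⟨x, y, ⟨h2, h3, h1⟩, h⟩
      rcases Sym2.eq_iff.1 h with ⟨rfl, rfl⟩ | ⟨rfl, rfl⟩
      · exact ⟨h1, h2, h3⟩
      · exact ⟨h1.symm, h3, h2⟩

lemma card_below {m : ℕ} (H : SimpleGraph (Fin m)) :
    Nat.card {G : SimpleGraph (Fin m) // G ≤ H} = 2 ^ H.edgeSet.ncard := by
  classical
  rw [← Set.ncard_powerset _ (Set.toFinite _), ← Nat.card_coe_set_eq]
  refine Nat.card_congr ⟨fun G => ⟨G.1.edgeSet, SimpleGraph.edgeSet_subset_edgeSet.2 G.2⟩,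
    fun s => ⟨SimpleGraph.fromEdgeSet s.1, ?_⟩, ?_, ?_⟩
  · rw [← SimpleGraph.edgeSet_subset_edgeSet, SimpleGraph.edgeSet_fromEdgeSet]
    exact Set.sdiff_subset.trans s.2
  · intro G; simp
  · rintro ⟨s, hs⟩
    simp only [SimpleGraph.edgeSet_fromEdgeSet, Subtype.mk.injEq]
    rw [sdiff_eq_left, Set.disjoint_left]
    intro e he he'
    exact SimpleGraph.not_isDiag_of_mem_edgeSet _ (hs he) he'

open Classical in
lemma sum_split {m : ℕ} (d : SimpleGraph (Fin m)) (F : SimpleGraph (Fin m) → ℝ)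
    (hF : ∀ G, F (G \ d) = F G) :
    ∑ G, (if Disjoint G d then F G else 0) = (2:ℝ)⁻¹ ^ d.edgeSet.ncard * ∑ G, F G := by
  let e : SimpleGraph (Fin m) ≃ {G : SimpleGraph (Fin m) // Disjoint G d} × {G : SimpleGraph (Fin m) // G ≤ d} :=
    { toFun := fun G => (⟨G \ d, disjoint_sdiff_self_left⟩, ⟨G ⊓ d, inf_le_right⟩)
      invFun := fun x => x.1.1 ⊔ x.2.1
      left_inv := fun G => by simp
      right_inv := by
        rintro ⟨⟨x, hx⟩, ⟨y, hy⟩⟩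
        simp only [Prod.mk.injEq, Subtype.mk.injEq]
        constructor
        · rw [sup_sdiff, sdiff_eq_bot_iff.2 hy, sup_bot_eq, sdiff_eq_left.2 hx]
        · rw [inf_sup_right, hx.eq_bot, bot_sup_eq, inf_eq_left.2 hy] }
  have h1 : ∑ G, F G = ∑ x : {G : SimpleGraph (Fin m) // Disjoint G d} × {G : SimpleGraph (Fin m) // G ≤ d}, F x.1.1 := by
    refine Fintype.sum_equiv e _ _ (fun G => ?_)
    exact (hF G).symm
  rw [h1, Fintype.sum_prod_type]
  simp only [Finset.sum_const, Finset.card_univ, nsmul_eq_mul]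
  rw [← Finset.mul_sum, ← Nat.card_eq_fintype_card, card_below]
  rw [← Finset.sum_filter]
  have h2 : ∑ a with Disjoint a d, F a = ∑ x : {G : SimpleGraph (Fin m) // Disjoint G d}, F x.1 := by
    rw [← Finset.sum_subtype_eq_sum_filter]; simp
  rw [h2]; push_cast
  rw [← mul_assoc, ← mul_pow]; norm_num

open Classical in
/-- Indicator of independence. -/
noncomputable def II {m : ℕ} (T : Finset (Fin m)) (G : SimpleGraph (Fin m)) : ℕ :=
  if IndepSet G T then 1 else 0

lemma numIndep_eq (m k : ℕ) (G : SimpleGraph (Fin m)) :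
    numIndep m k G = ∑ T ∈ Finset.powersetCard k Finset.univ, II T G := by
  classical
  unfold numIndep II
  rw [Finset.sum_ite, Finset.sum_const_zero, add_zero, Finset.sum_const, smul_eq_mul, mul_one]
  rw [Nat.card_eq_fintype_card]
  refine Fintype.card_of_subtype _ (fun T => ?_)
  simp

open Classical in
lemma sum_II_mul {m : ℕ} (T : Finset (Fin m)) (F : SimpleGraph (Fin m) → ℝ)
    (hF : ∀ G, F (G \ KT T) = F G) :
    ∑ G, (II T G : ℝ) * F G = (2:ℝ)⁻¹ ^ (T.card.choose 2) * ∑ G, F G := by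
  rw [← KT_card, ← sum_split _ F hF]
  refine Finset.sum_congr rfl (fun G _ => ?_)
  unfold II
  simp only [indep_iff]
  split_ifs <;> simp

open Classical in
lemma sum_II {m : ℕ} (T : Finset (Fin m)) :
    ∑ G, (II T G : ℝ) = (2:ℝ)⁻¹ ^ (T.card.choose 2) * (Fintype.card (SimpleGraph (Fin m)) : ℝ) := by
  have := sum_II_mul T (fun _ => 1) (fun _ => rfl)
  simpa using this

open Classical in
lemma sum_II_II {m k : ℕ} (S T : Finset (Fin m)) (hS : S.card = k) (hT : T.card = k) :
    ∑ G, (II T G : ℝ) * II S G = ((2:ℝ)⁻¹ ^ (k.choose 2)) ^ 2 * 2 ^ ((S ∩ T).card.choose 2)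
      * (Fintype.card (SimpleGraph (Fin m)) : ℝ) := by
  have h := sum_split (KT S ⊔ KT T) (fun _ => 1) (fun _ => rfl)
  have h1 : (KT S ⊔ KT T).edgeSet.ncard + (S ∩ T).card.choose 2 = k.choose 2 + k.choose 2 := by
    have := Set.ncard_union_add_ncard_inter (KT S).edgeSet (KT T).edgeSet
    rw [← SimpleGraph.edgeSet_sup, ← SimpleGraph.edgeSet_inf, KT_inf, KT_card, KT_card, KT_card, hS, hT] at this
    exact this
  have h2 : (2:ℝ)⁻¹ ^ (KT S ⊔ KT T).edgeSet.ncard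
      = ((2:ℝ)⁻¹ ^ (k.choose 2)) ^ 2 * 2 ^ ((S ∩ T).card.choose 2) := by
    rw [pow_two, ← pow_add, ← h1, pow_add, mul_assoc, ← mul_pow]; norm_num
  rw [h2] at h
  simp only [Finset.sum_const, Finset.card_univ, nsmul_eq_mul, mul_one] at h
  rw [← h]
  refine Finset.sum_congr rfl (fun G _ => ?_)
  unfold II
  simp only [indep_iff, disjoint_sup_right]
  split_ifs <;> simp_all

lemma II_sdiff {m : ℕ} (S T : Finset (Fin m)) (h : (S ∩ T).card ≤ 1) (G : SimpleGraph (Fin m)) :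
    II S (G \ KT T) = II S G := by
  classical
  have : IndepSet (G \ KT T) S ↔ IndepSet G S := by
    unfold IndepSet
    refine forall₄_congr (fun u hu v hv => not_congr ?_)
    rw [SimpleGraph.sdiff_adj]
    refine ⟨fun h => h.1, fun hG => ⟨hG, fun hK => hG.ne ?_⟩⟩
    exact Finset.card_le_one.1 h u (Finset.mem_inter.2 ⟨hu, hK.2.1⟩) v (Finset.mem_inter.2 ⟨hv, hK.2.2⟩)
  unfold II
  simp only [this]
lemma tv_T {m k : ℕ} (f : ℕ → ℝ) (hf : ∀ j, |f j| ≤ 2) (T : Finset (Fin m)) (hT : T.card = k) :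
    |∑ G, ((2:ℝ)⁻¹ ^ (k.choose 2) * f (numIndep m k G + 1) - II T G * f (numIndep m k G))|
    ≤ (Fintype.card (SimpleGraph (Fin m)) : ℝ) * (4 * ((2:ℝ)⁻¹ ^ (k.choose 2)) ^ 2 +
      8 * ∑ S ∈ Finset.powersetCard k (Finset.univ : Finset (Fin m)) with (S ≠ T ∧ 2 ≤ (S ∩ T).card),
        ((2:ℝ)⁻¹ ^ (k.choose 2)) ^ 2 * 2 ^ ((S ∩ T).card.choose 2)) := by
  classical
  set p : ℝ := (2:ℝ)⁻¹ ^ (k.choose 2) with hp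
  have hp0 : 0 < p := by positivity
  set N : ℝ := (Fintype.card (SimpleGraph (Fin m)) : ℝ) with hN
  have hN0 : 0 ≤ N := by positivity
  set U := Finset.powersetCard k (Finset.univ : Finset (Fin m)) with hU
  set Q := U.filter (fun S => S ≠ T ∧ 2 ≤ (S ∩ T).card) with hQ
  set R := U.filter (fun S => S ≠ T ∧ ¬ 2 ≤ (S ∩ T).card) with hR
  have hUc : ∀ S ∈ U, S.card = k := fun S hS => (Finset.mem_powersetCard.1 hS).2
  set Z : SimpleGraph (Fin m) → ℕ := fun G => ∑ S ∈ Q, II S G with hZ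
  set W : SimpleGraph (Fin m) → ℕ := fun G => ∑ S ∈ R, II S G with hW
  have hTU : T ∈ U := Finset.mem_powersetCard.2 ⟨Finset.subset_univ _, hT⟩
  have hX : ∀ G, numIndep m k G = II T G + (Z G + W G) := by
    intro G
    rw [numIndep_eq, ← Finset.add_sum_erase _ _ hTU, ← Finset.filter_ne',
      ← Finset.sum_filter_add_sum_filter_not _ (fun S => 2 ≤ (S ∩ T).card), Finset.filter_filter,
      Finset.filter_filter]
  have hWi : ∀ G, W (G \ KT T) = W G := by
    intro G
    refine Finset.sum_congr rfl (fun S hS => II_sdiff S T ?_ G)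
    have := (Finset.mem_filter.1 hS).2.2
    omega
  have hind := sum_II_mul T (fun G => f (W G + 1)) (fun G => by simp only [hWi])
  rw [hT, ← hp] at hind
  have heq : ∑ G, (p * f (numIndep m k G + 1) - II T G * f (numIndep m k G)) =
      ∑ G, (p * (f (numIndep m k G + 1) - f (W G + 1)) - II T G * (f (numIndep m k G) - f (W G + 1))) := by
    simp only [mul_sub, Finset.sum_sub_distrib, ← Finset.mul_sum] at hind ⊢
    linarith
  have hdiff : ∀ i j, |f i - f j| ≤ 4 := fun i j => by
    have := abs_sub (f i) (f j)
    linarith [hf i, hf j]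
  have hdiff2 : ∀ j z : ℕ, |f (j + z) - f j| ≤ 4 * z := by
    intro j z
    rcases Nat.eq_zero_or_pos z with rfl | hz
    · simp
    · have : (1:ℝ) ≤ z := by exact_mod_cast hz
      linarith [hdiff (j+z) j]
  have hpt : ∀ G, |p * (f (numIndep m k G + 1) - f (W G + 1)) - II T G * (f (numIndep m k G) - f (W G + 1))|
      ≤ 4 * p * II T G + 4 * (∑ S ∈ Q, p * II S G) + 4 * (∑ S ∈ Q, (II T G : ℝ) * (II S G : ℝ)) := by
    intro G
    rw [← Finset.mul_sum, ← Finset.mul_sum]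
    have hZc : (∑ S ∈ Q, (II S G : ℝ)) = Z G := by simp [hZ]
    rw [hZc]
    refine (abs_sub _ _).trans ?_
    rw [abs_mul, abs_mul, abs_of_pos hp0, abs_of_nonneg (by positivity : (0:ℝ) ≤ II T G)]
    have h1 : |f (numIndep m k G + 1) - f (W G + 1)| ≤ 4 * ((II T G : ℝ) + Z G) := by
      have := hdiff2 (W G + 1) (II T G + Z G)
      rw [hX, show II T G + (Z G + W G) + 1 = W G + 1 + (II T G + Z G) by ring]
      push_cast at this; exact this
    have h2 : (II T G : ℝ) * |f (numIndep m k G) - f (W G + 1)| ≤ II T G * (4 * Z G) := by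
      by_cases hI : IndepSet G T
      · have h3 : II T G = 1 := by simp [II, hI]
        have := hdiff2 (W G + 1) (Z G)
        rw [hX, h3, show 1 + (Z G + W G) = W G + 1 + Z G by ring]
        gcongr
      · have h3 : II T G = 0 := by simp [II, hI]
        simp [h3]
    have h4 := mul_le_mul_of_nonneg_left h1 hp0.le
    linarith
  rw [heq]
  refine (Finset.abs_sum_le_sum_abs _ _).trans ((Finset.sum_le_sum fun G _ => hpt G).trans ?_)
  rw [Finset.sum_add_distrib, Finset.sum_add_distrib, ← Finset.mul_sum, ← Finset.mul_sum, ← Finset.mul_sum,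
    Finset.sum_comm, Finset.sum_comm (t := Q), sum_II, hT, ← hp]
  have e1 : ∑ S ∈ Q, ∑ G, p * (II S G : ℝ) ≤ ∑ S ∈ Q, (p ^ 2 * 2 ^ ((S ∩ T).card.choose 2)) * N := by
    refine Finset.sum_le_sum (fun S hS => ?_)
    have hSk := hUc S (Finset.mem_filter.1 hS).1
    rw [← Finset.mul_sum, sum_II, hSk, ← hp, ← hN]
    have : (1:ℝ) ≤ 2 ^ ((S ∩ T).card.choose 2) := one_le_pow₀ (by norm_num)
    have h5 : 0 ≤ p ^ 2 * N := by positivity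
    nlinarith
  have e2 : ∑ S ∈ Q, ∑ G, (II T G : ℝ) * (II S G : ℝ) = ∑ S ∈ Q, (p ^ 2 * 2 ^ ((S ∩ T).card.choose 2)) * N := by
    refine Finset.sum_congr rfl (fun S hS => ?_)
    have hSk := hUc S (Finset.mem_filter.1 hS).1
    rw [sum_II_II S T hSk hT]
  rw [e2]
  rw [← Finset.sum_mul] at e1 ⊢
  rw [← hN]
  linarith

lemma tv_bound (m k : ℕ) (lam : ℝ) (hl : 1 ≤ lam) :
    dTVPoi m (fun G => numIndep m k G) lam ≤
      2 * |lam - m.choose k * (2:ℝ)⁻¹ ^ (k.choose 2)| +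
      ∑ T ∈ Finset.powersetCard k (Finset.univ : Finset (Fin m)), (4 * ((2:ℝ)⁻¹ ^ (k.choose 2)) ^ 2 +
      8 * ∑ S ∈ Finset.powersetCard k (Finset.univ : Finset (Fin m)) with (S ≠ T ∧ 2 ≤ (S ∩ T).card),
        ((2:ℝ)⁻¹ ^ (k.choose 2)) ^ 2 * 2 ^ ((S ∩ T).card.choose 2)) := by
  classical
  unfold dTVPoi
  refine ciSup_le (fun A => ?_)
  obtain ⟨f, hf, hs⟩ := stein_fun lam hl A
  set N : ℝ := (Fintype.card (SimpleGraph (Fin m)) : ℝ) with hN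
  have hN0 : 0 < N := by rw [hN]; exact_mod_cast Fintype.card_pos
  set P : ℝ := ∑' k : A, poiPMF lam k
  set p : ℝ := (2:ℝ)⁻¹ ^ (k.choose 2) with hp
  set U := Finset.powersetCard k (Finset.univ : Finset (Fin m)) with hU
  have hPr : Pr m (fun G => numIndep m k G ∈ A) - P =
      (∑ G, (lam * f (numIndep m k G + 1) - numIndep m k G * f (numIndep m k G))) / N := by
    rw [eq_div_iff hN0.ne', sub_mul, Pr, Nat.card_eq_fintype_card, Nat.card_eq_fintype_card,
      div_mul_cancel₀ _ hN0.ne']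
    simp_rw [hs]
    rw [Finset.sum_sub_distrib, Finset.sum_const, Finset.card_univ, nsmul_eq_mul, mul_comm P]
    congr 1
    rw [Fintype.card_subtype]
    simp [Set.indicator]
  rw [hPr, abs_div, abs_of_pos hN0, div_le_iff₀ hN0]
  have hUc : (U.card : ℝ) = m.choose k := by simp [hU]
  have hsplit : ∑ G, (lam * f (numIndep m k G + 1) - numIndep m k G * f (numIndep m k G)) =
      ∑ G, (lam - m.choose k * p) * f (numIndep m k G + 1) +
      ∑ T ∈ U, ∑ G, (p * f (numIndep m k G + 1) - II T G * f (numIndep m k G)) := by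
    rw [Finset.sum_comm, ← Finset.sum_add_distrib]
    refine Finset.sum_congr rfl (fun G _ => ?_)
    rw [Finset.sum_sub_distrib, ← Finset.sum_mul, ← Finset.sum_mul, Finset.sum_const, nsmul_eq_mul, hUc]
    have : (numIndep m k G : ℝ) = ∑ T ∈ U, (II T G : ℝ) := by rw [numIndep_eq]; push_cast; rfl
    rw [← this]; ring
  rw [hsplit]
  refine (abs_add_le _ _).trans ?_
  rw [add_mul]
  refine add_le_add ?_ ?_
  · refine (Finset.abs_sum_le_sum_abs _ _).trans ?_
    have : ∀ G ∈ (Finset.univ : Finset (SimpleGraph (Fin m))), |(lam - m.choose k * p) * f (numIndep m k G + 1)| ≤ 2 * |lam - m.choose k * p| := by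
      intro G _
      rw [abs_mul, mul_comm 2]
      exact mul_le_mul_of_nonneg_left (hf _) (abs_nonneg _)
    refine (Finset.sum_le_sum this).trans ?_
    rw [Finset.sum_const, Finset.card_univ, nsmul_eq_mul, mul_comm]
  · refine (Finset.abs_sum_le_sum_abs _ _).trans ?_
    rw [Finset.sum_mul]
    refine Finset.sum_le_sum (fun T hT => ?_)
    have := tv_T (k := k) f hf T (Finset.mem_powersetCard.1 hT).2
    rw [mul_comm _ N]
    exact this
lemma count_inter {m k : ℕ} (T : Finset (Fin m)) (hT : T.card = k) (l : ℕ) :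
    ((Finset.powersetCard k (Finset.univ : Finset (Fin m))).filter (fun S => (S ∩ T).card = l)).card
      ≤ k.choose l * (m - k).choose (k - l) := by
  classical
  have h1 : k.choose l * (m - k).choose (k - l) =
      (Finset.powersetCard l T ×ˢ Finset.powersetCard (k - l) Tᶜ).card := by
    rw [Finset.card_product, Finset.card_powersetCard, Finset.card_powersetCard, Finset.card_compl, hT]
    simp
  rw [h1]
  refine Finset.card_le_card_of_injOn (fun S => (S ∩ T, S \ T)) ?_ ?_
  · intro S hS
    simp only [Finset.coe_filter, Finset.mem_powersetCard, Finset.subset_univ, true_and, Set.mem_ofPred_eq] at hS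
    simp only [Finset.coe_product, Set.mem_prod, Finset.mem_coe, Finset.mem_powersetCard]
    refine ⟨⟨Finset.inter_subset_right, hS.2⟩, ?_, ?_⟩
    · intro x hx; simp only [Finset.mem_sdiff] at hx; simpa using hx.2
    · have := Finset.card_sdiff_add_card_inter S T
      omega
  · intro S _ S' _ h
    simp only [Prod.mk.injEq] at h
    rw [← Finset.sdiff_union_inter S T, ← Finset.sdiff_union_inter S' T, h.1, h.2]

lemma sum_count {m k : ℕ} (T : Finset (Fin m)) (hT : T.card = k) (q : ℝ) (hq : 0 ≤ q) :
    ∑ S ∈ Finset.powersetCard k (Finset.univ : Finset (Fin m)) with (S ≠ T ∧ 2 ≤ (S ∩ T).card),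
        q * 2 ^ ((S ∩ T).card.choose 2) ≤
    ∑ l ∈ Finset.Ico 2 k, (k.choose l * (m - k).choose (k - l) : ℝ) * (q * 2 ^ (l.choose 2)) := by
  classical
  rw [← Finset.sum_fiberwise_of_maps_to (t := Finset.Ico 2 k) (g := fun S => (S ∩ T).card)]
  · refine Finset.sum_le_sum (fun l _ => ?_)
    have : ∀ S ∈ ((Finset.powersetCard k (Finset.univ : Finset (Fin m))).filter
        (fun S => S ≠ T ∧ 2 ≤ (S ∩ T).card)).filter (fun S => (S ∩ T).card = l),
        q * 2 ^ ((S ∩ T).card.choose 2) = q * 2 ^ (l.choose 2) := by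
      intro S hS
      rw [(Finset.mem_filter.1 hS).2]
    rw [Finset.sum_congr rfl this, Finset.sum_const, nsmul_eq_mul]
    refine mul_le_mul_of_nonneg_right ?_ (by positivity)
    have h2 := count_inter T hT l
    have h3 : (((Finset.powersetCard k (Finset.univ : Finset (Fin m))).filter
        (fun S => S ≠ T ∧ 2 ≤ (S ∩ T).card)).filter (fun S => (S ∩ T).card = l)).card ≤
        ((Finset.powersetCard k (Finset.univ : Finset (Fin m))).filter (fun S => (S ∩ T).card = l)).card := by
      apply Finset.card_le_card
      exact Finset.filter_subset_filter _ (Finset.filter_subset _ _)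
    exact_mod_cast h3.trans h2
  · intro S hS
    simp only [Finset.mem_filter, Finset.mem_powersetCard, Finset.subset_univ, true_and] at hS
    rw [Finset.mem_Ico]
    refine ⟨hS.2.2, ?_⟩
    by_contra hc
    push Not at hc
    have h1 : S ∩ T = S := Finset.eq_of_subset_of_card_le Finset.inter_subset_left (by omega)
    have h2 : S ∩ T = T := Finset.eq_of_subset_of_card_le Finset.inter_subset_right (by omega)
    exact hS.2.1 (h1.symm.trans h2)

lemma tv_bound2 (m k : ℕ) (lam : ℝ) (hl : 1 ≤ lam) :
    dTVPoi m (fun G => numIndep m k G) lam ≤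
      2 * |lam - m.choose k * (2:ℝ)⁻¹ ^ (k.choose 2)| +
      (m.choose k * (2:ℝ)⁻¹ ^ (k.choose 2)) * (4 * ((2:ℝ)⁻¹ ^ (k.choose 2)) +
      8 * ∑ l ∈ Finset.Ico 2 k, (2:ℝ)⁻¹ ^ (k.choose 2) * (k.choose l * (m - k).choose (k - l) : ℝ) * 2 ^ (l.choose 2)) := by
  refine (tv_bound m k lam hl).trans ?_
  set p : ℝ := (2:ℝ)⁻¹ ^ (k.choose 2) with hp
  gcongr
  have : ∀ T ∈ Finset.powersetCard k (Finset.univ : Finset (Fin m)), (4 * p ^ 2 +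
      8 * ∑ S ∈ Finset.powersetCard k (Finset.univ : Finset (Fin m)) with (S ≠ T ∧ 2 ≤ (S ∩ T).card),
        p ^ 2 * 2 ^ ((S ∩ T).card.choose 2)) ≤ 4 * p ^ 2 + 8 * ∑ l ∈ Finset.Ico 2 k, (k.choose l * (m - k).choose (k - l) : ℝ) * (p ^ 2 * 2 ^ (l.choose 2)) := by
    intro T hT
    have := sum_count T (Finset.mem_powersetCard.1 hT).2 (p^2) (by positivity)
    gcongr
  refine (Finset.sum_le_sum this).trans ?_
  rw [Finset.sum_const, Finset.card_powersetCard, Finset.card_univ, Fintype.card_fin, nsmul_eq_mul, mul_assoc]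
  refine mul_le_mul_of_nonneg_left ?_ (by positivity)
  refine le_of_eq ?_
  simp only [mul_add, Finset.mul_sum]
  congr 1
  · ring
  · refine Finset.sum_congr rfl (fun l _ => by ring)

lemma desc_ratio (a m l : ℕ) (h : a ≤ m) : a.descFactorial l * m ^ l ≤ m.descFactorial l * a ^ l := by
  induction l with
  | zero => simp
  | succ l ih =>
    rw [Nat.descFactorial_succ, Nat.descFactorial_succ, pow_succ, pow_succ]
    have : (a - l) * m ≤ (m - l) * a := by
      rcases le_total a l with h1 | h1
      · simp [Nat.sub_eq_zero_of_le h1]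
      · obtain ⟨c, rfl⟩ := Nat.exists_eq_add_of_le h1
        obtain ⟨d, rfl⟩ := Nat.exists_eq_add_of_le h
        rw [Nat.add_sub_cancel_left, show l + c + d - l = c + d by omega]
        nlinarith
    calc _ = ((a - l) * m) * (a.descFactorial l * m ^ l) := by ring
      _ ≤ ((m - l) * a) * (m.descFactorial l * a ^ l) := Nat.mul_le_mul this ih
      _ = _ := by ring

lemma choose_ratio (a m l : ℕ) (h : a ≤ m) : a.choose l * m ^ l ≤ m.choose l * a ^ l := by
  have := desc_ratio a m l h
  rw [Nat.descFactorial_eq_factorial_mul_choose, Nat.descFactorial_eq_factorial_mul_choose, mul_assoc, mul_assoc] at this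
  exact Nat.le_of_mul_le_mul_left this (Nat.factorial_pos l)

lemma termA (m k l : ℕ) (hkm : k ≤ m) (hm : 0 < m) (hl2 : 2 ≤ l) (hlk : 2 * l ≤ k) (B : ℝ) (hB : B = (2:ℝ) ^ ((k:ℝ)/4))
    (hα : (k:ℝ)^2 * B / m ≤ 1) :
    (2:ℝ)⁻¹ ^ (k.choose 2) * (k.choose l * (m - k).choose (k - l) : ℝ) * 2 ^ (l.choose 2) ≤
      (m.choose k * (2:ℝ)⁻¹ ^ (k.choose 2)) * ((k:ℝ)^2 * B / m) ^ 2 := by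
  have hB0 : 0 < B := by rw [hB]; positivity
  have hm0 : (0:ℝ) < m := by exact_mod_cast hm
  have h1 : (2:ℝ) ^ (l.choose 2) ≤ B ^ l := by
    rw [hB, ← Real.rpow_natCast, ← Real.rpow_natCast, ← Real.rpow_mul (by norm_num)]
    apply Real.rpow_le_rpow_of_exponent_le (by norm_num)
    rw [Nat.cast_choose_two]
    have : (2 * l : ℝ) ≤ k := by exact_mod_cast hlk
    have : (0:ℝ) ≤ l := by positivity
    nlinarith
  have h2 : ((m - k).choose (k - l) : ℝ) ≤ m.choose k * ((k:ℝ) / m) ^ l := by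
    have h3 : (m - k).choose (k - l) ≤ (m - l).choose (k - l) := Nat.choose_le_choose _ (by omega)
    have h4 := Nat.choose_mul (n := m) (show l ≤ k by omega)
    have h5 := choose_ratio k m l hkm
    have h6 : 0 < m.choose l := Nat.choose_pos (by omega)
    have h7 : (m.choose l * m^l) * (m - l).choose (k - l) ≤ m.choose l * (m.choose k * k ^ l) := by
      calc _ = (m.choose l * (m - l).choose (k - l)) * m^l := by ring
        _ = m.choose k * (k.choose l * m ^ l) := by rw [← h4]; ring
        _ ≤ m.choose k * (m.choose l * k ^ l) := Nat.mul_le_mul_left _ h5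
        _ = _ := by ring
    rw [mul_assoc] at h7
    have h8 := Nat.le_of_mul_le_mul_left h7 h6
    have h9 : (m:ℝ)^l * (m - l).choose (k - l) ≤ m.choose k * (k:ℝ) ^ l := by exact_mod_cast h8
    rw [div_pow, mul_div_assoc', le_div_iff₀ (by positivity)]
    have : ((m - k).choose (k - l) : ℝ) ≤ (m - l).choose (k - l) := by exact_mod_cast h3
    have h10 : (0:ℝ) ≤ (m:ℝ)^l := by positivity
    nlinarith
  have h3 : (k.choose l : ℝ) ≤ (k:ℝ) ^ l := by exact_mod_cast Nat.choose_le_pow k l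
  have h4 : ((k:ℝ)^2 * B / m) ^ l ≤ ((k:ℝ)^2 * B / m) ^ 2 := pow_le_pow_of_le_one (by positivity) hα hl2
  calc _ ≤ (2:ℝ)⁻¹ ^ (k.choose 2) * ((k:ℝ) ^ l * (m.choose k * ((k:ℝ) / m) ^ l)) * B ^ l := by gcongr
    _ = (m.choose k * (2:ℝ)⁻¹ ^ (k.choose 2)) * ((k:ℝ)^2 * B / m) ^ l := by
      rw [div_pow, div_pow, mul_pow]; ring
    _ ≤ _ := by gcongr

lemma termB (m k l : ℕ) (hlk : l < k) (hlk2 : k ≤ 2 * l) (B : ℝ) (hB : B = (2:ℝ) ^ ((k:ℝ)/4))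
    (hβ : 2 * (k:ℝ) * m / B ^ 3 ≤ 1) :
    (2:ℝ)⁻¹ ^ (k.choose 2) * (k.choose l * (m - k).choose (k - l) : ℝ) * 2 ^ (l.choose 2) ≤
      2 * (k:ℝ) * m / B ^ 3 := by
  have hB0 : 0 < B := by rw [hB]; positivity
  obtain ⟨j, rfl⟩ := Nat.exists_eq_add_of_le hlk.le
  rw [Nat.add_sub_cancel_left]
  have hj : 1 ≤ j := by omega
  have h1 : (2:ℝ) ^ (l.choose 2) * (B ^ 3) ^ j ≤ 2 ^ j * 2 ^ ((l + j).choose 2) := by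
    rw [hB, ← Real.rpow_natCast, ← Real.rpow_natCast, ← Real.rpow_natCast, ← Real.rpow_natCast, ← Real.rpow_natCast, ← Real.rpow_mul (by positivity),
      ← Real.rpow_mul (by positivity), ← Real.rpow_add (by norm_num), ← Real.rpow_add (by norm_num)]
    apply Real.rpow_le_rpow_of_exponent_le (by norm_num)
    rw [Nat.cast_choose_two, Nat.cast_choose_two]
    have : (j : ℝ) ≤ l := by exact_mod_cast (by omega : j ≤ l)
    have : (0:ℝ) ≤ j := by positivity
    push_cast
    nlinarith
  have h2 : ((l+j).choose l : ℝ) ≤ ((l + j : ℕ):ℝ) ^ j := by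
    rw [Nat.choose_symm_add]
    exact_mod_cast Nat.choose_le_pow (l+j) j
  have h3 : ((m - (l+j)).choose j : ℝ) ≤ (m:ℝ) ^ j := by
    exact_mod_cast (Nat.choose_le_pow _ j).trans (Nat.pow_le_pow_left (Nat.sub_le _ _) j)
  have h4 : (2:ℝ)⁻¹ ^ ((l+j).choose 2) * 2 ^ (l.choose 2) ≤ 2 ^ j / (B^3) ^ j := by
    rw [le_div_iff₀ (by positivity), inv_pow, mul_assoc, inv_mul_le_iff₀ (by positivity)]
    linarith
  calc _ = ((2:ℝ)⁻¹ ^ ((l+j).choose 2) * 2 ^ (l.choose 2)) * (((l+j).choose l : ℝ) * ((m - (l+j)).choose j : ℝ)) := by ring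
    _ ≤ (2 ^ j / (B^3) ^ j) * (((l + j : ℕ):ℝ) ^ j * (m:ℝ)^j) := by gcongr
    _ = (2 * ((l + j : ℕ):ℝ) * m / B ^ 3) ^ j := by rw [div_pow, mul_pow, mul_pow]; ring
    _ ≤ (2 * ((l + j : ℕ):ℝ) * m / B ^ 3) ^ 1 := pow_le_pow_of_le_one (by positivity) hβ hj
    _ = _ := pow_one _

lemma tv_bound3 (m k : ℕ) (lam : ℝ) (hl : 1 ≤ lam) (hkm : k ≤ m) (hk : 3 ≤ k) (B α β L : ℝ) (hB : B = (2:ℝ) ^ ((k:ℝ)/4))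
    (hα : (k:ℝ)^2 * B / m ≤ α) (hβ : 2 * (k:ℝ) * m / B ^ 3 ≤ β) (hα1 : α ≤ 1) (hβ1 : β ≤ 1)
    (hL : L = m.choose k * (2:ℝ)⁻¹ ^ (k.choose 2)) :
    dTVPoi m (fun G => numIndep m k G) lam ≤
      2 * |lam - L| + 12 * k * (L * β + L ^ 2 * α ^ 2) := by
  refine (tv_bound2 m k lam hl).trans ?_
  rw [← hL]
  have hB0 : 0 < B := by rw [hB]; positivity
  have hB1 : 1 ≤ B := by rw [hB]; apply Real.one_le_rpow (by norm_num); positivity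
  have hm : 0 < m := by omega
  have hm0 : (1:ℝ) ≤ m := by exact_mod_cast hm
  have hk0 : (3:ℝ) ≤ k := by exact_mod_cast hk
  have hL0 : 0 ≤ L := by rw [hL]; positivity
  have hβ0 : 0 ≤ β := le_trans (by positivity) hβ
  have hp : (2:ℝ)⁻¹ ^ (k.choose 2) ≤ β := by
    refine le_trans ?_ hβ
    have h1 : B ^ 3 ≤ 2 ^ (k.choose 2) := by
      rw [hB, ← Real.rpow_natCast, ← Real.rpow_natCast, ← Real.rpow_mul (by norm_num)]
      apply Real.rpow_le_rpow_of_exponent_le (by norm_num)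
      rw [Nat.cast_choose_two]
      push_cast; nlinarith
    rw [inv_pow, le_div_iff₀ (by positivity), inv_mul_le_iff₀ (by positivity)]
    have : (1:ℝ) ≤ 2 * k * m := by nlinarith
    have h2 : (0:ℝ) < 2 ^ (k.choose 2) := by positivity
    nlinarith
  have hsum : ∑ l ∈ Finset.Ico 2 k, (2:ℝ)⁻¹ ^ (k.choose 2) * (k.choose l * (m - k).choose (k - l) : ℝ) * 2 ^ (l.choose 2)
      ≤ ∑ l ∈ Finset.Ico 2 k, (β + L * α ^ 2) := by
    refine Finset.sum_le_sum (fun l hlm => ?_)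
    rw [Finset.mem_Ico] at hlm
    rcases le_total (2 * l) k with h | h
    · have := termA m k l hkm hm hlm.1 h B hB (hα.trans hα1)
      rw [← hL] at this
      have h2 : L * ((k:ℝ)^2 * B / m)^2 ≤ L * α ^ 2 := by gcongr
      linarith
    · have := termB m k l hlm.2 h B hB (hβ.trans hβ1)
      have : 0 ≤ L * α ^ 2 := by positivity
      linarith
  rw [Finset.sum_const, nsmul_eq_mul, Nat.card_Ico] at hsum
  have hc : ((k - 2 : ℕ) : ℝ) * (β + L * α ^ 2) ≤ k * (β + L * α ^ 2) := by
    gcongr; omega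
  have h0 : 0 ≤ L * α ^ 2 := by positivity
  have h9 : β ≤ k * (β + L * α ^ 2) := by nlinarith
  have : 4 * (2:ℝ)⁻¹ ^ (k.choose 2) + 8 * ∑ l ∈ Finset.Ico 2 k, (2:ℝ)⁻¹ ^ (k.choose 2) * (k.choose l * (m - k).choose (k - l) : ℝ) * 2 ^ (l.choose 2)
     ≤ 12 * (k * (β + L * α ^ 2)) := by linarith
  have := mul_le_mul_of_nonneg_left this hL0
  linarith
lemma desc_ratio2 (n d k l : ℕ) (hk : k ≤ n) (hl : l ≤ k) :
    (n + d).descFactorial l * (n - k) ^ l ≤ n.descFactorial l * (n + d - k) ^ l := by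
  induction l with
  | zero => simp
  | succ l ih =>
    rw [Nat.descFactorial_succ, Nat.descFactorial_succ, pow_succ, pow_succ]
    have : (n + d - l) * (n - k) ≤ (n - l) * (n + d - k) := by
      obtain ⟨c, rfl⟩ := Nat.exists_eq_add_of_le hk
      obtain ⟨e, rfl⟩ := Nat.exists_eq_add_of_le hl
      rw [show l + 1 + e + c + d - l = 1 + e + c + d by omega, show l + 1 + e + c - (l + 1 + e) = c by omega,
        show l + 1 + e + c - l = 1 + e + c by omega, show l + 1 + e + c + d - (l + 1 + e) = c + d by omega]
      nlinarith
    calc _ = ((n + d - l) * (n - k)) * ((n + d).descFactorial l * (n - k) ^ l) := by ring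
      _ ≤ ((n - l) * (n + d - k)) * (n.descFactorial l * (n + d - k) ^ l) := Nat.mul_le_mul this (ih (by omega))
      _ = _ := by ring

lemma choose_grow (n d k : ℕ) (hn : 0 < n) (hk : 2 * k ≤ n) (h1 : 2 * (d:ℝ) * k / n ≤ 1) :
    ((n + d).choose k : ℝ) ≤ n.choose k * (1 + 4 * d * k / n) := by
  have h := desc_ratio2 n d k k (by omega) le_rfl
  rw [Nat.descFactorial_eq_factorial_mul_choose, Nat.descFactorial_eq_factorial_mul_choose, mul_assoc, mul_assoc] at h
  have h2 := Nat.le_of_mul_le_mul_left h (Nat.factorial_pos k)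
  obtain ⟨c, rfl⟩ := Nat.exists_eq_add_of_le (show k ≤ n by omega)
  rw [show k + c - k = c by omega, show k + c + d - k = c + d by omega] at h2
  have h3 : ((k + c + d).choose k : ℝ) * (c:ℝ) ^ k ≤ (k + c).choose k * ((c:ℝ) + d) ^ k := by exact_mod_cast h2
  have hc : (0:ℝ) < c := by exact_mod_cast (by omega : 0 < c)
  have hkc : (k:ℝ) ≤ c := by exact_mod_cast (by omega : k ≤ c)
  have hkc0 : (0:ℝ) < ((k + c : ℕ) : ℝ) := by exact_mod_cast hn
  have h4 : (((c:ℝ) + d) / c) ^ k ≤ 1 + 4 * d * k / ((k + c : ℕ) : ℝ) := by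
    have e1 : ((c:ℝ) + d) / c ≤ Real.exp (2 * d / ((k + c : ℕ):ℝ)) := by
      have : ((c:ℝ) + d) / c = d / c + 1 := by field_simp; ring
      rw [this]
      refine le_trans ?_ (Real.add_one_le_exp _)
      have h7 : (d:ℝ) / c ≤ 2 * d / ((k + c : ℕ):ℝ) := by
        rw [div_le_div_iff₀ hc hkc0]
        push_cast
        have : (0:ℝ) ≤ d := by positivity
        nlinarith
      linarith
    calc _ ≤ (Real.exp (2 * d / ((k + c : ℕ):ℝ))) ^ k := by gcongr
      _ = Real.exp (2 * d * k / ((k + c : ℕ):ℝ)) := by rw [← Real.exp_nat_mul]; congr 1; ring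
      _ ≤ 1 + 2 * (2 * d * k / ((k + c : ℕ):ℝ)) := by
        have h0 : 0 ≤ 2 * (d:ℝ) * k / ((k + c : ℕ):ℝ) := by positivity
        have := Real.abs_exp_sub_one_le (x := 2 * (d:ℝ) * k / ((k + c : ℕ):ℝ)) (by rwa [abs_of_nonneg h0])
        rw [abs_of_nonneg h0] at this
        linarith [le_abs_self (Real.exp (2 * (d:ℝ) * k / ((k + c : ℕ):ℝ)) - 1)]
      _ = _ := by ring
  calc ((k + c + d).choose k : ℝ) ≤ (k + c).choose k * ((c:ℝ) + d) ^ k / (c:ℝ) ^ k := by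
        rw [le_div_iff₀ (by positivity)]; exact h3
    _ = (k + c).choose k * (((c:ℝ) + d) / c) ^ k := by rw [div_pow]; ring
    _ ≤ _ := by gcongr

set_option maxHeartbeats 2000000 in
lemma main_m (n d : ℕ) (y t η : ℝ) (hn : 0 < n) (hy : y = Real.logb 2 n) (ht : t = (n:ℝ) ^ ((1:ℝ)/4)) (hy4 : 4 ≤ y)
    (hyt : 8 * y ^ 3 ≤ t) (hmu1 : 1 ≤ mu n) (hmu : mu n ≤ t ^ 2 * η) (hη0 : 0 ≤ η) (hη1 : η ≤ 1)
    (hd : (d:ℝ) ≤ t * aa n) :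
    dTVPoi (n + d) (fun G => numIndep (n + d) (aa n) G) (mu n) ≤
      32 * (y ^ 2 / t) + 384 * (y ^ 4 * η) + 1536 * (y ^ 5 * η ^ 2) := by
  set k := aa n with hk
  have hn0 : (0:ℝ) < n := by exact_mod_cast hn
  have hny : (n:ℝ) = 2 ^ y := by rw [hy, Real.rpow_logb (by norm_num) (by norm_num) hn0]
  have hty : t = 2 ^ (y / 4) := by
    rw [ht, hny, ← Real.rpow_mul (by norm_num)]; congr 1; ring
  have hnt : (n:ℝ) = t ^ 4 := by
    rw [hty, hny, ← Real.rpow_natCast, ← Real.rpow_mul (by norm_num)]; congr 1; push_cast; ring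
  have hy0 : 0 < y := by linarith
  have hy2 : y ^ 2 ≤ t := by nlinarith [sq_nonneg y]
  have ht1 : 16 ≤ t := by nlinarith
  have ht0 : 0 < t := by linarith
  set z := Real.logb 2 y with hz
  have hz2 : 2 ≤ z := by
    rw [hz, Real.le_logb_iff_rpow_le (by norm_num) hy0]; norm_num; exact hy4
  have hzy : 2 * z ≤ y / 4 := by
    have : Real.logb 2 (y ^ 2) ≤ y / 4 := by
      rw [Real.logb_le_iff_le_rpow (by norm_num) (by positivity), ← hty]; exact hy2
    rw [Real.logb_pow] at this
    exact_mod_cast this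
  have hyz : y = 2 ^ z := by rw [hz, Real.rpow_logb (by norm_num) (by norm_num) hy0]
  have hα0 : alpha0 n = 2 * y - 2 * z + 2 * Real.logb 2 (Real.exp 1 / 2) + 1 := by
    rw [alpha0, ← hy]
  have he0 : 0 ≤ Real.logb 2 (Real.exp 1 / 2) := by
    apply Real.logb_nonneg (by norm_num); linarith [Real.exp_one_gt_d9]
  have he1 : Real.logb 2 (Real.exp 1 / 2) ≤ 1 := by
    rw [Real.logb_le_iff_le_rpow (by norm_num) (by positivity)]
    norm_num; linarith [Real.exp_one_lt_d9]
  have hk2 : (k:ℝ) ≤ 2 * y := by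
    have : (k:ℝ) ≤ alpha0 n := by rw [hk, aa]; exact Nat.floor_le (by rw [hα0]; linarith)
    rw [hα0] at this; linarith
  have hkl : 2 * y - 2 * z ≤ k := by
    have : alpha0 n < k + 1 := by rw [hk, aa]; exact Nat.lt_floor_add_one _
    rw [hα0] at this; linarith
  have hk3 : 3 ≤ k := by
    have : (3:ℝ) ≤ k := by linarith
    exact_mod_cast this
  have hk0 : (0:ℝ) ≤ k := by positivity
  have hd0 : (0:ℝ) ≤ d := by positivity
  have hd2 : (d:ℝ) ≤ t * (2 * y) := hd.trans (by gcongr)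
  have hyt' : y ≤ t := by nlinarith
  have hkn : 2 * k ≤ n := by
    have : (2 * k : ℝ) ≤ n := by
      have : 4 * y ≤ t ^ 4 := by 
        have h3 : 4 ≤ t ^ 3 := by nlinarith [(by nlinarith : 256 ≤ t^2)]
        calc 4 * y ≤ t ^ 3 * t := by gcongr
          _ = t ^ 4 := by ring
      rw [hnt]; linarith
    exact_mod_cast this
  have hdn : (d:ℝ) ≤ n := by
    have h1 : 2 * y ≤ t ^ 3 := by nlinarith [(by nlinarith : 256 ≤ t^2)]
    calc (d:ℝ) ≤ t * (2 * y) := hd2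
      _ ≤ t * t ^ 3 := by gcongr
      _ = n := by rw [hnt]; ring
  have hdk : (d:ℝ) * k / n ≤ 4 * y ^ 2 / t ^ 3 := by
    rw [div_le_div_iff₀ hn0 (by positivity), hnt]
    calc (d:ℝ) * k * t ^ 3 ≤ (t * (2 * y)) * (2 * y) * t ^ 3 := by gcongr
      _ = _ := by ring
  have hdk1 : 4 * y ^ 2 / t ^ 3 ≤ 1/4 := by
    rw [div_le_iff₀ (by positivity)]
    nlinarith [(by nlinarith : 256 ≤ t^2)]
  have hgrow := choose_grow n d k hn hkn (by
    have : 2 * (d:ℝ) * k / n = 2 * (d * k / n) := by ring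
    rw [this]; linarith)
  set p : ℝ := (2:ℝ)⁻¹ ^ (k.choose 2) with hp
  have hp0 : 0 < p := by positivity
  have hmup : mu n = n.choose k * p := rfl
  set Λ : ℝ := (n + d).choose k * p with hΛ
  have hΛ1 : mu n ≤ Λ := by
    rw [hmup, hΛ]
    have : (n.choose k : ℝ) ≤ (n + d).choose k := by exact_mod_cast Nat.choose_le_choose k (Nat.le_add_right n d)
    gcongr
  have hΛ2 : Λ ≤ mu n * (1 + 4 * (d * k / n)) := by
    rw [hmup, hΛ]
    calc _ ≤ (n.choose k * (1 + 4 * d * k / n)) * p := by gcongr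
      _ = _ := by ring
  have hmut : mu n ≤ t ^ 2 := hmu.trans (mul_le_of_le_one_right (by positivity) hη1)
  have hdiff : |mu n - Λ| ≤ 16 * (y ^ 2 / t) := by
    rw [abs_sub_comm, abs_of_nonneg (by linarith)]
    calc Λ - mu n ≤ mu n * (4 * (d * k / n)) := by linarith
      _ ≤ t ^ 2 * (4 * (4 * y ^ 2 / t ^ 3)) := by gcongr
      _ = _ := by field_simp; ring
  have hΛ3 : Λ ≤ 2 * (t ^ 2 * η) := by
    have : mu n * (1 + 4 * (d * k / n)) ≤ mu n * 2 := by gcongr; linarith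
    linarith
  set B : ℝ := (2:ℝ) ^ ((k:ℝ)/4) with hB
  have hB0 : 0 < B := by positivity
  have hBt : B ≤ t ^ 2 := by
    rw [hB, hty, ← Real.rpow_natCast, ← Real.rpow_mul (by norm_num)]
    apply Real.rpow_le_rpow_of_exponent_le (by norm_num)
    push_cast; linarith
  have hB3 : t ^ 6 / y ^ 2 ≤ B ^ 3 := by
    rw [div_le_iff₀ (by positivity)]
    rw [hB, hty]
    nth_rewrite 2 [hyz]
    rw [← Real.rpow_natCast, ← Real.rpow_natCast, ← Real.rpow_natCast, ← Real.rpow_mul (by norm_num),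
      ← Real.rpow_mul (by norm_num), ← Real.rpow_mul (by norm_num), ← Real.rpow_add (by norm_num)]
    apply Real.rpow_le_rpow_of_exponent_le (by norm_num)
    push_cast; linarith
  have key := fun α β => tv_bound3 (n + d) k (mu n) hmu1 (by omega) hk3 B α β Λ hB
  clear_value B p Λ z k
  have hm1 : (n:ℝ) ≤ ((n + d : ℕ):ℝ) := by push_cast; linarith
  have hm2 : ((n + d : ℕ):ℝ) ≤ 2 * n := by push_cast; linarith
  have hα : (k:ℝ)^2 * B / ((n + d : ℕ):ℝ) ≤ 4 * y ^ 2 / t ^ 2 := by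
    calc _ ≤ (2 * y) ^ 2 * t ^ 2 / n := by gcongr
      _ = _ := by rw [hnt]; field_simp; ring
  have hβ : 2 * (k:ℝ) * ((n + d : ℕ):ℝ) / B ^ 3 ≤ 8 * y ^ 3 / t ^ 2 := by
    calc _ ≤ 2 * (2 * y) * (2 * n) / (t ^ 6 / y ^ 2) := by gcongr
      _ = _ := by rw [hnt]; field_simp; ring
  have hα1 : 4 * y ^ 2 / t ^ 2 ≤ 1 := by
    rw [div_le_iff₀ (by positivity)]; nlinarith
  have hβ1 : 8 * y ^ 3 / t ^ 2 ≤ 1 := by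
    rw [div_le_iff₀ (by positivity)]; nlinarith
  refine (key _ _ hα hβ hα1 hβ1 (by rw [hΛ, hp])).trans ?_
  have hΛ0 : 0 ≤ Λ := by linarith
  have e1 : Λ * (8 * y ^ 3 / t ^ 2) ≤ 16 * (y ^ 3 * η) := by
    calc _ ≤ (2 * (t ^ 2 * η)) * (8 * y ^ 3 / t ^ 2) := by gcongr
      _ = _ := by field_simp; ring
  have e2 : Λ ^ 2 * (4 * y ^ 2 / t ^ 2) ^ 2 ≤ 64 * (y ^ 4 * η ^ 2) := by
    calc _ ≤ (2 * (t ^ 2 * η)) ^ 2 * (4 * y ^ 2 / t ^ 2) ^ 2 := by gcongr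
      _ = _ := by field_simp; ring
  have e3 : 12 * k * (Λ * (8 * y ^ 3 / t ^ 2) + Λ ^ 2 * (4 * y ^ 2 / t ^ 2) ^ 2) ≤
      12 * (2 * y) * (16 * (y ^ 3 * η) + 64 * (y ^ 4 * η ^ 2)) := by gcongr
  have e4 : 12 * (2 * y) * (16 * (y ^ 3 * η) + 64 * (y ^ 4 * η ^ 2)) = 384 * (y ^ 4 * η) + 1536 * (y ^ 5 * η ^ 2) := by ring
  linarith

lemma lim_aux (j : ℕ) (s : ℝ) (hs : 0 < s) :
    Tendsto (fun n : ℕ => (Real.logb 2 n) ^ j * (n:ℝ) ^ (-s)) atTop (nhds 0) := by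
  have h := (isLittleO_log_rpow_rpow_atTop (j:ℝ) hs).tendsto_div_nhds_zero
  have h2 := (h.comp tendsto_natCast_atTop_atTop).const_mul ((Real.log 2)⁻¹ ^ j)
  rw [mul_zero] at h2
  refine h2.congr (fun n => ?_)
  simp only [Function.comp, Real.rpow_natCast]
  rw [Real.rpow_neg (by positivity), Real.logb, div_pow, inv_pow]
  ring

/-- For `ε < x(n) < 1/2 − ε`, with `r = ⌊n^{x(n)/2}⌋` and `n′ = n + r·a(n)`,
both `d_TV(X_a, Poi_{μ(n)})` and `d_TV(X′_a, Poi_{μ(n)})` are `o(1)`. -/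
theorem stmt8 (ε : ℝ) (hε : 0 < ε) (hε4 : ε < 1/4) :
    ∀ δ > (0:ℝ), ∃ N : ℕ, ∀ n ≥ N, ε < xx n → xx n < 1/2 - ε →
      dTVPoi n (fun G => numIndep n (aa n) G) (mu n) ≤ δ ∧
      dTVPoi (n + ⌊(n : ℝ) ^ (xx n / 2)⌋₊ * aa n)
        (fun G => numIndep (n + ⌊(n : ℝ) ^ (xx n / 2)⌋₊ * aa n) (aa n) G) (mu n) ≤ δ := by
  intro δ hδ
  have h1 := lim_aux 2 (1/4) (by norm_num)
  have h2 := lim_aux 4 ε hε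
  have h3 := lim_aux 5 (2 * ε) (by linarith)
  have h4 := lim_aux 3 (1/4) (by norm_num)
  have hlim : Tendsto (fun n : ℕ => 32 * ((Real.logb 2 n) ^ 2 * (n:ℝ) ^ (-(1/4:ℝ))) +
      384 * ((Real.logb 2 n) ^ 4 * (n:ℝ) ^ (-ε)) + 1536 * ((Real.logb 2 n) ^ 5 * (n:ℝ) ^ (-(2 * ε))))
      atTop (nhds 0) := by
    have := ((h1.const_mul 32).add (h2.const_mul 384)).add (h3.const_mul 1536)
    simpa using this
  have E1 := hlim.eventually (ge_mem_nhds hδ)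
  have E2 := h4.eventually (ge_mem_nhds (show (0:ℝ) < 1/8 by norm_num))
  obtain ⟨N, hN⟩ := eventually_atTop.1 (E1.and (E2.and (eventually_ge_atTop 16)))
  refine ⟨N, fun n hn hx1 hx2 => ?_⟩
  obtain ⟨F1, F2, F3⟩ := hN n hn
  have hn0 : 0 < n := by omega
  have hn0' : (0:ℝ) < n := by exact_mod_cast hn0
  have hn16 : (16:ℝ) ≤ n := by exact_mod_cast F3
  have hlog : 0 < Real.log n := Real.log_pos (by linarith)
  have hlm : Real.log (mu n) = xx n * Real.log n := by
    rw [xx, div_mul_cancel₀ _ hlog.ne']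
  have hmu0 : 0 ≤ mu n := by unfold mu; positivity
  have hlm0 : 0 < Real.log (mu n) := by rw [hlm]; exact mul_pos (by linarith) hlog
  have hmu1 : 1 < mu n := (Real.log_pos_iff hmu0).1 hlm0
  have hmux : mu n = (n:ℝ) ^ (xx n) := by
    rw [Real.rpow_def_of_pos hn0', mul_comm, ← hlm, Real.exp_log (by linarith)]
  set y := Real.logb 2 n with hy
  set t := (n:ℝ) ^ ((1:ℝ)/4) with ht
  have ht0 : 0 < t := by positivity
  have hn1 : (1:ℝ) ≤ n := by linarith
  have htn : (n:ℝ) ^ (-(1/4:ℝ)) = t⁻¹ := Real.rpow_neg (by positivity) _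
  have hη2 : (n:ℝ) ^ (-(2 * ε)) = ((n:ℝ) ^ (-ε)) ^ 2 := by
    rw [← Real.rpow_natCast, ← Real.rpow_mul (by positivity)]; congr 1; push_cast; ring
  have hy4 : 4 ≤ y := by
    rw [hy, Real.le_logb_iff_rpow_le (by norm_num) hn0']; norm_num; exact F3
  have hyt : 8 * y ^ 3 ≤ t := by
    rw [htn, ← div_eq_mul_inv, div_le_iff₀ ht0] at F2; linarith
  have hmu : mu n ≤ t ^ 2 * (n:ℝ) ^ (-ε) := by
    rw [hmux, ht, ← Real.rpow_natCast, ← Real.rpow_mul (by positivity), ← Real.rpow_add hn0']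
    apply Real.rpow_le_rpow_of_exponent_le hn1
    push_cast; linarith
  have hη1 : (n:ℝ) ^ (-ε) ≤ 1 := Real.rpow_le_one_of_one_le_of_nonpos hn1 (by linarith)
  have hη0 : 0 ≤ (n:ℝ) ^ (-ε) := by positivity
  rw [htn, hη2, ← div_eq_mul_inv] at F1
  constructor
  · exact (main_m n 0 y t _ hn0 hy ht hy4 hyt hmu1.le hmu hη0 hη1 (by push_cast; positivity)).trans F1
  · refine (main_m n _ y t _ hn0 hy ht hy4 hyt hmu1.le hmu hη0 hη1 ?_).trans F1
    push_cast
    gcongr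
    refine (Nat.floor_le (by positivity)).trans ?_
    rw [ht]
    apply Real.rpow_le_rpow_of_exponent_le hn1
    linarith
end

section
/- Fix ε ∈ (0, 1/2). Then with high probability all independent a(n)-sets of G(n,1/2) are pairwise disjoint, along n with μ(n) ≤ n^{1/2 − ε}. Precisely: for every δ > 0 there is N such that for all n ≥ N with μ(n) ≤ n^{1/2 − ε}, the probability that every two distinct independent a(n)-sets of G(n,1/2) are disjoint is at least 1 − δ. -/
open Filter

/-- All independent `k`-sets of `G` are pairwise disjoint. -/
def AllDisjoint (n k : ℕ) (G : SimpleGraph (Fin n)) : Prop :=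
  ∀ S T : Finset (Fin n), S.card = k → T.card = k →
    IndepSet G S → IndepSet G T → S ≠ T → Disjoint S T

open Finset in
noncomputable def EE {n : ℕ} (S : Finset (Fin n)) : Finset (Sym2 (Fin n)) := S.offDiag.image Sym2.mk.uncurry

theorem mem_EE {n : ℕ} (S : Finset (Fin n)) (u v : Fin n) :
    s(u,v) ∈ EE S ↔ u ∈ S ∧ v ∈ S ∧ u ≠ v := by
  unfold EE
  simp only [Finset.mem_image, Finset.mem_offDiag, Prod.exists, Function.uncurry]
  constructor
  · rintro ⟨x, y, ⟨hx, hy, hxy⟩, h⟩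
    rw [Sym2.eq_iff] at h
    rcases h with ⟨rfl, rfl⟩ | ⟨rfl, rfl⟩
    · exact ⟨hx, hy, hxy⟩
    · exact ⟨hy, hx, hxy.symm⟩
  · rintro h
    exact ⟨u, v, h, rfl⟩

theorem card_EE {n : ℕ} (S : Finset (Fin n)) : (EE S).card = S.card.choose 2 := by
  unfold EE
  exact Sym2.card_image_offDiag S

theorem EE_inter {n : ℕ} (S T : Finset (Fin n)) : EE S ∩ EE T = EE (S ∩ T) := by
  ext e
  induction e using Sym2.ind with
  | _ u v => simp only [Finset.mem_inter, mem_EE]; tauto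

theorem total_ge (n : ℕ) : 2 ^ (n.choose 2) ≤ Nat.card (SimpleGraph (Fin n)) := by
  classical
  have h : Nat.card ((EE (Finset.univ : Finset (Fin n))).powerset) = 2 ^ (n.choose 2) := by
    rw [Nat.card_eq_fintype_card, Fintype.card_coe, Finset.card_powerset, card_EE, Finset.card_univ, Fintype.card_fin]
  rw [← h]
  apply Nat.card_le_card_of_injective (fun X => SimpleGraph.fromEdgeSet (X.1 : Set (Sym2 (Fin n))))
  rintro ⟨X, hX⟩ ⟨Y, hY⟩ h
  simp only [Finset.mem_powerset] at hX hY
  apply Subtype.ext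
  ext e
  induction e using Sym2.ind with
  | _ u v =>
    have h2 : (SimpleGraph.fromEdgeSet (X : Set (Sym2 (Fin n)))).Adj u v ↔
      (SimpleGraph.fromEdgeSet (Y : Set (Sym2 (Fin n)))).Adj u v := by
        simp only at h
        rw [h]
    simp only [SimpleGraph.fromEdgeSet_adj, Finset.mem_coe] at h2
    have h3 := fun h => ((mem_EE _ u v).1 (hX h)).2.2
    have h4 := fun h => ((mem_EE _ u v).1 (hY h)).2.2
    tauto

theorem indep_le {n : ℕ} (S T : Finset (Fin n)) :
    Nat.card {G : SimpleGraph (Fin n) // IndepSet G S ∧ IndepSet G T} ≤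
      2 ^ ((EE (Finset.univ : Finset (Fin n)) \ (EE S ∪ EE T)).card) := by
  classical
  have h : Nat.card ((EE (Finset.univ : Finset (Fin n)) \ (EE S ∪ EE T)).powerset) =
      2 ^ ((EE (Finset.univ : Finset (Fin n)) \ (EE S ∪ EE T)).card) := by
    rw [Nat.card_eq_fintype_card, Fintype.card_coe, Finset.card_powerset]
  rw [← h]
  apply Nat.card_le_card_of_injective (fun G => ⟨(EE (Finset.univ : Finset (Fin n))).filter (fun e => e ∈ G.1.edgeSet), by
    obtain ⟨G, h1, h2⟩ := G
    rw [Finset.mem_powerset]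
    intro e he
    induction e using Sym2.ind with
    | _ u v =>
      simp only [Finset.mem_filter, SimpleGraph.mem_edgeSet] at he
      simp only [Finset.mem_sdiff, Finset.mem_union, mem_EE]
      refine ⟨(mem_EE _ u v).1 he.1, ?_⟩
      rintro (h | h)
      · exact h1 u h.1 v h.2.1 he.2
      · exact h2 u h.1 v h.2.1 he.2⟩)
  rintro ⟨G, hG⟩ ⟨H, hH⟩ h
  apply Subtype.ext
  ext u v
  have h2 := congrArg (fun X => s(u,v) ∈ X.1) h
  simp only [Finset.mem_filter, SimpleGraph.mem_edgeSet, mem_EE, Finset.mem_univ, true_and, eq_iff_iff] at h2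
  have h3 : G.Adj u v → u ≠ v := fun h => h.ne
  have h4 : H.Adj u v → u ≠ v := fun h => h.ne
  tauto

/-- probability both are independent -/
theorem pr_indep {n a l : ℕ} (S T : Finset (Fin n)) (hS : S.card = a) (hT : T.card = a)
    (hl : (S ∩ T).card = l) :
    Pr n (fun G => IndepSet G S ∧ IndepSet G T) ≤ (2:ℝ)⁻¹ ^ (2 * a.choose 2 - l.choose 2) := by
  have hU : (EE S ∪ EE T).card = 2 * a.choose 2 - l.choose 2 := by
    rw [Finset.card_union, EE_inter, card_EE, card_EE, card_EE, hS, hT, hl, two_mul]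
  have hsub : EE S ∪ EE T ⊆ EE (Finset.univ : Finset (Fin n)) := by
    intro e
    induction e using Sym2.ind with
    | _ u v => simp only [Finset.mem_union, mem_EE, Finset.mem_univ]; tauto
  have h1 := indep_le S T
  have h2 := Finset.card_sdiff_add_card_eq_card hsub
  rw [card_EE, Finset.card_univ, Fintype.card_fin, hU] at h2
  have h3 := total_ge n
  unfold Pr
  have h3' : (2:ℝ) ^ (n.choose 2) ≤ (Nat.card (SimpleGraph (Fin n)) : ℝ) := by exact_mod_cast h3
  have h1' : (Nat.card {G : SimpleGraph (Fin n) // IndepSet G S ∧ IndepSet G T} : ℝ) ≤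
      2 ^ ((EE (Finset.univ : Finset (Fin n)) \ (EE S ∪ EE T)).card) := by exact_mod_cast h1
  have hpos : (0:ℝ) < 2 ^ (n.choose 2) := by positivity
  rw [div_le_iff₀ (lt_of_lt_of_le hpos h3')]
  refine h1'.trans ?_
  refine le_trans ?_ (mul_le_mul_of_nonneg_left h3' (by positivity))
  rw [← h2, pow_add, inv_pow]
  apply le_of_eq
  field_simp

/-- the number of `T` meeting `S` in `l` elements -/
theorem count_T {n a l : ℕ} (S : Finset (Fin n)) (hS : S.card = a) :
    (Finset.univ.filter (fun T : Finset (Fin n) => T.card = a ∧ (S ∩ T).card = l)).card ≤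
      a.choose l * (n - a).choose (a - l) := by
  classical
  have h : (S.powersetCard l ×ˢ (Sᶜ).powersetCard (a - l)).card = a.choose l * (n - a).choose (a - l) := by
    rw [Finset.card_product, Finset.card_powersetCard, Finset.card_powersetCard, Finset.card_compl, hS,
      Fintype.card_fin]
  rw [← h]
  apply Finset.card_le_card_of_injOn (fun T => (S ∩ T, T \ S))
  · intro T hT
    simp only [Finset.coe_filter, Finset.mem_univ, true_and, Set.mem_ofPred_eq] at hT
    simp only [Finset.coe_product, Set.mem_prod, Finset.mem_coe, Finset.mem_powersetCard]
    refine ⟨⟨Finset.inter_subset_left, hT.2⟩, ?_, ?_⟩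
    · intro x; simp
    · have := Finset.card_sdiff_add_card_inter T S
      rw [Finset.inter_comm] at this
      omega
  · intro T _ T' _ h
    simp only [Prod.mk.injEq] at h
    ext x
    have h1 := congrArg (x ∈ ·) h.1
    have h2 := congrArg (x ∈ ·) h.2
    simp at h1 h2
    tauto

noncomputable def term (n a l : ℕ) : ℝ :=
  (n.choose a : ℝ) * ((a.choose l : ℝ) * ((n - a).choose (a - l) : ℝ)) *
    (2:ℝ)⁻¹ ^ (2 * a.choose 2 - l.choose 2)

noncomputable def GG (n : ℕ) (P : SimpleGraph (Fin n) → Prop) : Finset (SimpleGraph (Fin n)) :=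
  (Set.toFinite {G | P G}).toFinset

theorem mem_GG {n : ℕ} {P : SimpleGraph (Fin n) → Prop} {G : SimpleGraph (Fin n)} : G ∈ GG n P ↔ P G := by
  simp [GG]

theorem GG_card (n : ℕ) (P : SimpleGraph (Fin n) → Prop) :
    Nat.card {G : SimpleGraph (Fin n) // P G} = (GG n P).card := by
  rw [← Nat.card_eq_finsetCard]
  exact Nat.card_congr (Equiv.subtypeEquivRight fun G => mem_GG.symm)

theorem GG_compl (n : ℕ) (P : SimpleGraph (Fin n) → Prop) :
    (GG n P).card + (GG n (fun G => ¬ P G)).card = Nat.card (SimpleGraph (Fin n)) := by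
  classical
  have h : GG n (fun G => ¬ P G) = (GG n P)ᶜ := by
    ext G; simp [mem_GG]
  rw [h, Finset.card_add_card_compl, Nat.card_eq_fintype_card]

theorem Pr_bad (n a : ℕ) :
    1 - Pr n (fun G => AllDisjoint n a G) ≤ ∑ l ∈ Finset.Ico 1 a, term n a l := by
  classical
  set A := (Finset.univ.filter (fun S : Finset (Fin n) => S.card = a)) with hA
  set B := fun (S : Finset (Fin n)) (l : ℕ) =>
    (Finset.univ.filter (fun T : Finset (Fin n) => T.card = a ∧ (S ∩ T).card = l)) with hB
  have hNpos : (0:ℝ) < (Nat.card (SimpleGraph (Fin n)) : ℝ) := by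
    have := total_ge n
    have h2 : 0 < 2 ^ (n.choose 2) := by positivity
    exact_mod_cast lt_of_lt_of_le h2 this
  have hPr : ∀ P : SimpleGraph (Fin n) → Prop, Pr n P =
      ((GG n P).card : ℝ) / (Nat.card (SimpleGraph (Fin n)) : ℝ) := by
    intro P
    unfold Pr
    rw [GG_card]
  have key : (GG n (fun G => ¬ AllDisjoint n a G)).card ≤
      ∑ S ∈ A, ∑ l ∈ Finset.Ico 1 a, ∑ T ∈ B S l,
        (GG n (fun G => IndepSet G S ∧ IndepSet G T)).card := by
    have hsub : (GG n (fun G => ¬ AllDisjoint n a G)) ⊆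
      A.biUnion (fun S => (Finset.Ico 1 a).biUnion (fun l => (B S l).biUnion (fun T =>
        (GG n (fun G => IndepSet G S ∧ IndepSet G T))))) := by
      intro G hG
      simp only [mem_GG, AllDisjoint] at hG
      push Not at hG
      obtain ⟨S, T, hS, hT, h1, h2, hne, hd⟩ := hG
      simp only [Finset.mem_biUnion, Finset.mem_filter, Finset.mem_univ, true_and, A, B, Finset.mem_Ico, mem_GG]
      refine ⟨S, hS, (S ∩ T).card, ⟨?_, ?_⟩, T, ⟨hT, rfl⟩, h1, h2⟩
      · rw [Nat.one_le_iff_ne_zero, Ne, Finset.card_eq_zero, ← Finset.disjoint_iff_inter_eq_empty]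
        exact hd
      · rw [← hS]
        apply Finset.card_lt_card
        refine ⟨Finset.inter_subset_left, fun h => hne ?_⟩
        apply Finset.eq_of_subset_of_card_le
        · exact h.trans Finset.inter_subset_right
        · omega
    refine (Finset.card_le_card hsub).trans ?_
    refine Finset.card_biUnion_le.trans (Finset.sum_le_sum fun S _ => ?_)
    refine Finset.card_biUnion_le.trans (Finset.sum_le_sum fun l _ => ?_)
    exact Finset.card_biUnion_le
  have h1 : 1 - Pr n (fun G => AllDisjoint n a G) = Pr n (fun G => ¬ AllDisjoint n a G) := by
    rw [hPr, hPr, eq_div_iff hNpos.ne', sub_mul, div_mul_cancel₀ _ hNpos.ne', one_mul]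
    rw [← GG_compl n (fun G => AllDisjoint n a G)]; push_cast; ring
  rw [h1, hPr]
  calc _ ≤ ((∑ S ∈ A, ∑ l ∈ Finset.Ico 1 a, ∑ T ∈ B S l,
        (GG n (fun G => IndepSet G S ∧ IndepSet G T)).card : ℕ) : ℝ) / (Nat.card (SimpleGraph (Fin n)) : ℝ) := by
        gcongr
    _ = ∑ S ∈ A, ∑ l ∈ Finset.Ico 1 a, ∑ T ∈ B S l, Pr n (fun G => IndepSet G S ∧ IndepSet G T) := by
        push_cast
        simp only [Finset.sum_div, hPr]
    _ ≤ ∑ S ∈ A, ∑ l ∈ Finset.Ico 1 a, ((a.choose l : ℝ) * ((n - a).choose (a - l) : ℝ)) *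
    (2:ℝ)⁻¹ ^ (2 * a.choose 2 - l.choose 2) := by
        refine Finset.sum_le_sum fun S hS => Finset.sum_le_sum fun l _ => ?_
        have hS' : S.card = a := by simpa [A] using hS
        refine (Finset.sum_le_card_nsmul _ _ ((2:ℝ)⁻¹ ^ (2 * a.choose 2 - l.choose 2)) ?_).trans ?_
        · intro T hT
          simp only [B, Finset.mem_filter, Finset.mem_univ, true_and] at hT
          exact pr_indep S T hS' hT.1 hT.2
        · rw [nsmul_eq_mul]
          gcongr
          exact_mod_cast count_T S hS'
    _ = _ := by
        have hc : A.card = n.choose a := by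
          have := Finset.card_powersetCard a (Finset.univ : Finset (Fin n))
          rw [Finset.card_univ, Fintype.card_fin] at this
          rw [← this]
          congr 1
          ext S; simp [A, Finset.mem_powersetCard]
        rw [Finset.sum_const, hc, nsmul_eq_mul, Finset.mul_sum]
        refine Finset.sum_congr rfl fun l _ => ?_
        unfold term; ring

theorem desc_ineq {n a : ℕ} (han : a ≤ n) (l : ℕ) :
    a.descFactorial l * n ^ l ≤ n.descFactorial l * a ^ l := by
  induction l with
  | zero => simp
  | succ l ih =>
    rw [Nat.descFactorial_succ, Nat.descFactorial_succ, pow_succ, pow_succ]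
    have h : (a - l) * n ≤ (n - l) * a := by
      rw [Nat.sub_mul, Nat.sub_mul, Nat.mul_comm n a]
      exact Nat.sub_le_sub_left (Nat.mul_le_mul_left l han) _
    calc _ = ((a - l) * n) * (a.descFactorial l * n ^ l) := by ring
      _ ≤ ((n - l) * a) * (n.descFactorial l * a ^ l) := Nat.mul_le_mul h ih
      _ = _ := by ring

theorem choose_ineq {n a l : ℕ} (han : a ≤ n) (hl : l ≤ a) :
    (n - a).choose (a - l) * n ^ l ≤ a ^ l * n.choose a := by
  have h1 : (n - a).choose (a - l) ≤ (n - l).choose (a - l) := Nat.choose_le_choose _ (by omega)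
  have h2 : a.choose l * n ^ l ≤ n.choose l * a ^ l := by
    have := desc_ineq han l
    rw [Nat.descFactorial_eq_factorial_mul_choose, Nat.descFactorial_eq_factorial_mul_choose,
      mul_assoc, mul_assoc] at this
    exact Nat.le_of_mul_le_mul_left this (Nat.factorial_pos l)
  have h3 : n.choose a * a.choose l = n.choose l * (n - l).choose (a - l) := Nat.choose_mul hl
  have h4 : 0 < n.choose l := Nat.choose_pos (by omega)
  refine (Nat.mul_le_mul_right _ h1).trans ?_
  apply Nat.le_of_mul_le_mul_left _ h4
  calc n.choose l * ((n - l).choose (a - l) * n ^ l) = n.choose a * (a.choose l * n ^ l) := by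
        rw [← mul_assoc, ← h3, mul_assoc]
    _ ≤ n.choose a * (n.choose l * a ^ l) := Nat.mul_le_mul_left _ h2
    _ = _ := by ring

theorem choose_two_mul (l : ℕ) : 2 * l.choose 2 = l * (l - 1) := by
  rw [Nat.choose_two_right]
  exact Nat.mul_div_cancel' (Nat.even_mul_pred_self l).two_dvd

theorem term_first {n a l : ℕ} {r : ℝ} (hr : 0 < r) (hrn : r ^ 2 = n) (han : a ≤ n) (hl1 : 1 ≤ l)
    (hl : 2 * l ≤ a) (h2a : 2 ^ a ≤ n ^ 2) (ha : (a : ℝ) ^ 2 ≤ r) :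
    term n a l ≤ ((n.choose a : ℝ) * (2 : ℝ)⁻¹ ^ (a.choose 2)) ^ 2 * ((a:ℝ) ^ 2 / n) := by
  have hn : (0:ℝ) < n := by rw [← hrn]; positivity
  have hll : l.choose 2 ≤ 2 * a.choose 2 := by
    have : l.choose 2 ≤ a.choose 2 := Nat.choose_le_choose _ (by omega)
    omega
  have hq : (2:ℝ)⁻¹ ^ (2 * a.choose 2 - l.choose 2) = ((2:ℝ)⁻¹ ^ (a.choose 2)) ^ 2 * 2 ^ (l.choose 2) := by
    rw [← pow_mul, mul_comm (a.choose 2) 2]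
    nth_rw 2 [← Nat.sub_add_cancel hll]
    rw [pow_add, mul_assoc, ← mul_pow]; norm_num
  have hc : ((n - a).choose (a - l) : ℝ) ≤ (a:ℝ) ^ l * n.choose a / n ^ l := by
    rw [le_div_iff₀ (by positivity)]
    exact_mod_cast choose_ineq han (by omega : l ≤ a)
  have hc2 : (a.choose l : ℝ) ≤ (a:ℝ) ^ l := by exact_mod_cast Nat.choose_le_pow a l
  have h2l : (2:ℝ) ^ l ≤ n := by
    have h : (2 ^ l) ^ 2 ≤ n ^ 2 := by
      rw [← pow_mul]
      exact (Nat.pow_le_pow_right (by norm_num) (by omega)).trans h2a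
    have := (Nat.pow_le_pow_iff_left (by norm_num)).1 h
    exact_mod_cast this
  have h2 : (2:ℝ) ^ (l.choose 2) ≤ r ^ (l - 1) := by
    have : ((2:ℝ) ^ (l.choose 2)) ^ 2 ≤ (r ^ (l - 1)) ^ 2 := by
      rw [← pow_mul, mul_comm (l.choose 2), choose_two_mul, pow_mul, ← pow_mul r, mul_comm (l - 1), pow_mul, hrn]
      gcongr
    exact (pow_le_pow_iff_left₀ (by positivity) (by positivity) (by norm_num)).1 this
  obtain ⟨k, rfl⟩ : ∃ k, l = k + 1 := ⟨l - 1, by omega⟩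
  simp only [Nat.add_sub_cancel] at h2
  unfold term
  rw [hq]
  calc _ ≤ (n.choose a : ℝ) * ((a:ℝ) ^ (k+1) * ((a:ℝ) ^ (k+1) * n.choose a / n ^ (k+1))) *
        (((2:ℝ)⁻¹ ^ (a.choose 2)) ^ 2 * r ^ k) := by gcongr
    _ = ((n.choose a : ℝ) * (2 : ℝ)⁻¹ ^ (a.choose 2)) ^ 2 * ((a:ℝ) ^ 2 / n) * ((a:ℝ)^2 / r) ^ k := by
        rw [← hrn]
        have : r ≠ 0 := hr.ne'
        rw [div_pow]
        field_simp
        ring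
    _ ≤ _ := by
        apply mul_le_of_le_one_right (by positivity)
        apply pow_le_one₀ (by positivity)
        rw [div_le_one hr]; exact ha

theorem term_second {n a j : ℕ} {r L : ℝ} (hr : 0 < r) (hrn : r ^ 2 = n) (hj1 : 1 ≤ j)
    (hj : 2 * j ≤ a) (hL : 2 ≤ L) (h2a : (n:ℝ) ^ 2 ≤ L ^ 2 * 2 ^ a) (ha : (a : ℝ) * L ^ 2 ≤ r) :
    term n a (a - j) ≤ ((n.choose a : ℝ) * (2 : ℝ)⁻¹ ^ (a.choose 2)) * ((a:ℝ) * L ^ 2 / r) := by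
  have hn : (0:ℝ) < n := by rw [← hrn]; positivity
  set D := a.choose 2 - (a - j).choose 2 with hD
  have hle : (a - j).choose 2 ≤ a.choose 2 := Nat.choose_le_choose _ (by omega)
  have hq : (2:ℝ)⁻¹ ^ (2 * a.choose 2 - (a - j).choose 2) = (2:ℝ)⁻¹ ^ (a.choose 2) * (2:ℝ)⁻¹ ^ D := by
    rw [← pow_add]; congr 1; omega
  have hD4 : j * (3 * a) ≤ 4 * D + 2 * j := by
    have e1 := choose_two_mul a
    have e2 := choose_two_mul (a - j)
    obtain ⟨b, rfl⟩ : ∃ b, a = b + j := ⟨a - j, by omega⟩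
    obtain ⟨i, rfl⟩ : ∃ i, j = i + 1 := ⟨j - 1, by omega⟩
    obtain ⟨c, rfl⟩ : ∃ c, b = c + 1 := ⟨b - 1, by omega⟩
    have hD' : D + (c + 1).choose 2 = (c + 1 + (i + 1)).choose 2 := by
      rw [hD]; simp only [Nat.add_sub_cancel] at hle ⊢; omega
    simp only [Nat.add_sub_cancel] at e2
    have e3 : c + 1 + (i + 1) - 1 = c + i + 1 := by omega
    rw [e3] at e1
    have hic : i ≤ c := by omega
    nlinarith
  have h2D : (r ^ 3 / L ^ 2) ^ j ≤ 2 ^ D := by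
    have h3 : ((r ^ 3 / L ^ 2) ^ j) ^ 4 * 2 ^ (2 * j) ≤ (2 ^ D) ^ 4 * 2 ^ (2 * j) := by
      have e1 : ((2:ℝ) ^ D) ^ 4 * 2 ^ (2 * j) = 2 ^ (4 * D + 2 * j) := by rw [← pow_mul, ← pow_add]; congr 1; ring
      rw [e1]
      refine le_trans ?_ (pow_le_pow_right₀ (by norm_num) hD4)
      have e2 : ((r ^ 3 / L ^ 2) ^ j) ^ 4 * 2 ^ (2 * j) = ((r^3 / L^2) ^ 4 * 4) ^ j := by
        rw [mul_pow, ← pow_mul, ← pow_mul, pow_mul 2 2 j, mul_comm j 4]; norm_num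
      rw [e2, mul_comm j, pow_mul (2:ℝ) (3*a) j]
      apply pow_le_pow_left₀ (by positivity)
      have e4 : ((n:ℝ)^2) ^ 3 ≤ (L^2 * 2 ^ a) ^ 3 := pow_le_pow_left₀ (by positivity) h2a 3
      rw [← hrn, mul_pow, ← pow_mul 2 a 3, mul_comm a 3] at e4
      rw [div_pow, div_mul_eq_mul_div, div_le_iff₀ (by positivity)]
      have hL2 : 4 ≤ L ^ 2 := by nlinarith
      calc (r^3)^4 * 4 = ((r^2)^2)^3 * 4 := by ring
        _ ≤ ((L^2)^3 * 2 ^ (3 * a)) * L^2 := by gcongr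
        _ = _ := by ring
    have h4 := le_of_mul_le_mul_right h3 (by positivity)
    exact (pow_le_pow_iff_left₀ (by positivity) (by positivity) (by norm_num)).1 h4
  have hqD : (2:ℝ)⁻¹ ^ D ≤ (L ^ 2 / r ^ 3) ^ j := by
    rw [inv_pow, ← inv_div, inv_pow]
    exact inv_anti₀ (by positivity) h2D
  have hc1 : (a.choose (a - j) : ℝ) ≤ (a:ℝ) ^ j := by
    rw [Nat.choose_symm (by omega : j ≤ a)]
    exact_mod_cast Nat.choose_le_pow a j
  have hc2 : ((n - a).choose (a - (a - j)) : ℝ) ≤ (n:ℝ) ^ j := by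
    rw [Nat.sub_sub_self (by omega : j ≤ a)]
    exact_mod_cast (Nat.choose_le_pow (n - a) j).trans (Nat.pow_le_pow_left (Nat.sub_le n a) j)
  unfold term
  rw [hq]
  calc _ ≤ (n.choose a : ℝ) * ((a:ℝ) ^ j * (n:ℝ) ^ j) * ((2:ℝ)⁻¹ ^ (a.choose 2) * (L ^ 2 / r ^ 3) ^ j) := by gcongr
    _ = ((n.choose a : ℝ) * (2 : ℝ)⁻¹ ^ (a.choose 2)) * ((a:ℝ) * L ^ 2 / r) ^ j := by
        have : (a:ℝ) * L ^ 2 / r = a * n * (L ^ 2 / r ^ 3) := by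
          rw [← hrn]; field_simp
        rw [this, mul_pow, mul_pow]; ring
    _ ≤ _ := by
        apply mul_le_mul_of_nonneg_left _ (by positivity)
        apply pow_le_of_le_one (by positivity) _ (by omega)
        rw [div_le_one hr]; exact ha

theorem aa_bounds (n : ℕ) (hL : 4 ≤ Real.logb 2 n) (hn : 0 < n) :
    (aa n : ℝ) ≤ 2 * Real.logb 2 n ∧ (2:ℝ) ^ (aa n) ≤ (n:ℝ) ^ 2 ∧
      (n:ℝ) ^ 2 ≤ (Real.logb 2 n) ^ 2 * 2 ^ (aa n) := by
  have hn' : (0:ℝ) < n := by exact_mod_cast hn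
  set L := Real.logb 2 n with hLdef
  have hnL : (n:ℝ) = 2 ^ L := (Real.rpow_logb (by norm_num) (by norm_num) hn').symm
  have hLL : 2 ≤ Real.logb 2 L := by
    rw [Real.le_logb_iff_rpow_le (by norm_num) (by linarith)]
    norm_num; linarith
  have he1 : 0 ≤ Real.logb 2 (Real.exp 1 / 2) := by
    apply Real.logb_nonneg (by norm_num)
    have := Real.add_one_le_exp 1
    linarith
  have he2 : Real.logb 2 (Real.exp 1 / 2) ≤ 1 := by
    rw [Real.logb_le_iff_le_rpow (by norm_num) (by positivity)]
    have := Real.exp_one_lt_d9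
    norm_num; linarith
  have hup : (aa n : ℝ) ≤ 2 * L := by
    unfold aa
    rcases le_or_gt 0 (alpha0 n) with h | h
    · refine (Nat.floor_le h).trans ?_
      unfold alpha0
      rw [← hLdef]; linarith
    · rw [Nat.floor_of_nonpos h.le]; simp; linarith
  have hlo : 2 * L - 2 * Real.logb 2 L ≤ aa n := by
    have := Nat.lt_floor_add_one (alpha0 n)
    unfold aa
    have h2 : alpha0 n = 2 * L - 2 * Real.logb 2 L + 2 * Real.logb 2 (Real.exp 1 / 2) + 1 := rfl
    linarith
  have hn2 : (n:ℝ) ^ 2 = 2 ^ (2 * L) := by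
    rw [hnL, ← Real.rpow_natCast, ← Real.rpow_mul (by norm_num)]; congr 1; push_cast; ring
  refine ⟨hup, ?_, ?_⟩
  · rw [hn2, ← Real.rpow_natCast]
    exact Real.rpow_le_rpow_of_exponent_le (by norm_num) hup
  · have hL2 : L ^ 2 = (2:ℝ) ^ (2 * Real.logb 2 L) := by
      have : L = (2:ℝ) ^ (Real.logb 2 L) := (Real.rpow_logb (by norm_num) (by norm_num) (by linarith)).symm
      nth_rw 1 [this]
      rw [← Real.rpow_natCast, ← Real.rpow_mul (by norm_num)]; congr 1; push_cast; ring
    rw [hn2, hL2, ← Real.rpow_natCast, ← Real.rpow_add (by norm_num)]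
    exact Real.rpow_le_rpow_of_exponent_le (by norm_num) (by linarith)

theorem ev_log (s c : ℝ) (hs : 0 < s) (hc : 0 < c) (k : ℕ) :
    ∀ᶠ n : ℕ in atTop, (Real.logb 2 n) ^ k ≤ c * (n:ℝ) ^ s := by
  have h1 := (isLittleO_log_rpow_rpow_atTop (k:ℝ) hs).def
    (show 0 < c * (Real.log 2) ^ k by have := Real.log_pos (show (1:ℝ) < 2 by norm_num); positivity)
  have h2 := tendsto_natCast_atTop_atTop (R := ℝ) |>.eventually h1
  filter_upwards [h2, eventually_ge_atTop 1] with n hn hn1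
  have hl2 := Real.log_pos (show (1:ℝ) < 2 by norm_num)
  have hn1' : (1:ℝ) ≤ n := by exact_mod_cast hn1
  have hl := Real.log_nonneg hn1'
  rw [Real.rpow_natCast, Real.norm_of_nonneg (by positivity), Real.norm_of_nonneg (by positivity)] at hn
  rw [Real.logb, div_pow, div_le_iff₀ (by positivity)]
  linarith

/-- Fix `ε ∈ (0,1/2)`. Along `n` with `μ(n) ≤ n^{1/2−ε}`, whp all independent
`a(n)`-sets of `G(n,1/2)` are pairwise disjoint. -/
theorem stmt9 (ε : ℝ) (hε : 0 < ε) (hε2 : ε < 1/2) :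
    ∀ δ > (0:ℝ), ∃ N : ℕ, ∀ n ≥ N, mu n ≤ (n : ℝ) ^ ((1:ℝ)/2 - ε) →
      1 - δ ≤ Pr n (fun G => AllDisjoint n (aa n) G) := by
  intro δ hδ
  rw [← eventually_atTop]
  have hLinf : ∀ᶠ n : ℕ in atTop, 4 ≤ Real.logb 2 n :=
    ((Real.tendsto_logb_atTop (by norm_num)).comp tendsto_natCast_atTop_atTop).eventually_ge_atTop 4
  filter_upwards [hLinf, eventually_ge_atTop 1, ev_log ε (δ / 8) hε (by positivity) 4,
    ev_log (1/2) (1/2) (by norm_num) (by norm_num) 3] with n hL hn1 h4 h3 hmu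
  obtain ⟨hup, h2a, hlo⟩ := aa_bounds n hL hn1
  set L := Real.logb 2 n with hLdef
  set a := aa n with hadef
  have hn : (1:ℝ) ≤ n := by exact_mod_cast hn1
  set r : ℝ := (n:ℝ) ^ ((1:ℝ)/2) with hrdef
  have hr : 0 < r := by positivity
  have hr1 : 1 ≤ r := Real.one_le_rpow hn (by norm_num)
  have hrn : r ^ 2 = n := by
    rw [hrdef, ← Real.rpow_natCast, ← Real.rpow_mul (by linarith)]; norm_num
  have h3' : 2 * L ^ 3 ≤ r := by linarith
  have ha0 : (0:ℝ) ≤ a := by positivity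
  have haL : (a:ℝ) * L ^ 2 ≤ r := by
    have : (a:ℝ) * L ^ 2 ≤ 2 * L * L ^ 2 := by gcongr
    nlinarith
  have ha2 : (a:ℝ) ^ 2 ≤ r := by
    have h : (a:ℝ) ^ 2 ≤ (2 * L) ^ 2 := by gcongr
    have h' : 0 ≤ L ^ 2 * (L - 4) := mul_nonneg (by positivity) (by linarith)
    nlinarith
  have han : a ≤ n := by
    have : (a:ℝ) ≤ n := by
      have h1 : (a:ℝ) * 1 ≤ a * L ^ 2 := by gcongr; nlinarith
      nlinarith
    exact_mod_cast this
  set w : ℝ := (n:ℝ) ^ (-ε) with hwdef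
  have hw : 0 < w := by positivity
  have hw1 : w ≤ 1 := Real.rpow_le_one_of_one_le_of_nonpos hn (by linarith)
  have hmu' : mu n ≤ r * w := by
    refine hmu.trans (le_of_eq ?_)
    rw [hrdef, hwdef, ← Real.rpow_add (by linarith)]; rfl
  have hmu0 : 0 ≤ mu n := by unfold mu; positivity
  have hmudef : mu n = (n.choose a : ℝ) * (2 : ℝ)⁻¹ ^ (a.choose 2) := rfl
  have hterm : ∀ l ∈ Finset.Ico 1 a, term n a l ≤ 4 * L ^ 3 * w := by
    intro l hl
    rw [Finset.mem_Ico] at hl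
    rcases le_or_gt (2 * l) a with h | h
    · have := term_first hr hrn han hl.1 h (by exact_mod_cast h2a) ha2
      rw [← hmudef] at this
      refine this.trans ?_
      calc _ ≤ (r * w) ^ 2 * ((2 * L) ^ 2 / n) := by gcongr
        _ = 4 * L ^ 2 * w * w := by rw [← hrn]; field_simp; ring
        _ ≤ 4 * L ^ 2 * w * 1 := by gcongr
        _ ≤ 4 * L ^ 3 * w := by
          have : L ^ 2 ≤ L ^ 3 := pow_le_pow_right₀ (by linarith) (by norm_num)
          nlinarith
    · have := term_second (n := n) (a := a) (j := a - l) hr hrn (by omega) (by omega) (by linarith : 2 ≤ L) hlo haL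
      rw [← hmudef, Nat.sub_sub_self (by omega)] at this
      refine this.trans ?_
      calc _ ≤ (r * w) * ((2 * L) * L ^ 2 / r) := by gcongr
        _ = 2 * L ^ 3 * w := by field_simp
        _ ≤ 4 * L ^ 3 * w := by gcongr; norm_num
  have hbad := Pr_bad n a
  have hsum := Finset.sum_le_card_nsmul _ _ _ hterm
  rw [Nat.card_Ico, nsmul_eq_mul] at hsum
  have hcard : ((a - 1 : ℕ) : ℝ) ≤ 2 * L := by
    refine le_trans ?_ hup
    exact_mod_cast Nat.sub_le a 1
  have hfin : ((a - 1 : ℕ) : ℝ) * (4 * L ^ 3 * w) ≤ δ := by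
    calc _ ≤ 2 * L * (4 * L ^ 3 * w) := by gcongr
      _ = 8 * L ^ 4 * w := by ring
      _ ≤ 8 * (δ / 8 * (n:ℝ) ^ ε) * w := by gcongr
      _ = δ * ((n:ℝ) ^ ε * w) := by ring
      _ = δ := by rw [hwdef, ← Real.rpow_add (by linarith)]; simp
  linarith
end
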